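/- arXiv:2508.12658 — 11 statements merged into one kernel-verified Lean document; each statement's English description precedes it below -/
import Mathlib

section
/- There exists a constant m > 0 such that every alternating 3-form ψ on ℝ⁷ with ‖ψ − φ₀‖ < m lies in the GL(7,ℝ)-orbit of φ₀; that is, there exists a linear automorphism g of ℝ⁷ with ψ(v₁,v₂,v₃) = φ₀(g v₁, g v₂, g v₃) for all v₁,v₂,v₃ ∈ ℝ⁷. Equivalently, the GL(7,ℝ)-orbit of φ₀ in the (finite-dimensional, hence canonically topologized) space of alternating 3-forms on ℝ⁷ is a neighborhood of φ₀. -/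
/-- The coordinate 3-form `e^{ijk}` on `ℝ⁷`: the pullback of the determinant form on `ℝ³`
along the projection onto the coordinates `i, j, k`. -/
noncomputable def eForm (i j k : Fin 7) : AlternatingMap ℝ (Fin 7 → ℝ) ℝ (Fin 3) :=
  ((Pi.basisFun ℝ (Fin 3)).det).compLinearMap (LinearMap.funLeft ℝ ℝ ![i, j, k])

/-- The standard G₂ 3-form `φ₀ = e^{123}+e^{145}+e^{167}+e^{246}−e^{257}−e^{347}−e^{356}`
on `ℝ⁷` (indices here are 0-based). -/
noncomputable def phi0 : AlternatingMap ℝ (Fin 7 → ℝ) ℝ (Fin 3) :=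
  eForm 0 1 2 + eForm 0 3 4 + eForm 0 5 6 + eForm 1 3 5
    - eForm 1 4 6 - eForm 2 3 6 - eForm 2 4 5


/-- Coordinate expression of `eForm`. -/
lemma eForm_apply (i j k : Fin 7) (v : Fin 3 → Fin 7 → ℝ) :
    eForm i j k v = v 0 i * v 1 j * v 2 k - v 0 i * v 2 j * v 1 k
      - v 1 i * v 0 j * v 2 k + v 1 i * v 2 j * v 0 k
      + v 2 i * v 0 j * v 1 k - v 2 i * v 1 j * v 0 k := by
  rw [eForm, AlternatingMap.compLinearMap_apply, Module.Basis.det_apply, Matrix.det_fin_three]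
  simp only [Module.Basis.toMatrix_apply, Pi.basisFun_repr, LinearMap.funLeft_apply,
    Matrix.cons_val]

lemma phi0_continuous : Continuous (fun v : Fin 3 → Fin 7 → ℝ => phi0 v) := by
  simp only [phi0, AlternatingMap.add_apply, AlternatingMap.sub_apply, eForm_apply]
  fun_prop

/-- `phi0` as a continuous multilinear map. -/
noncomputable def phiC : ContinuousMultilinearMap ℝ (fun _ : Fin 3 => Fin 7 → ℝ) ℝ :=
  ⟨phi0.toMultilinearMap, phi0_continuous⟩

lemma phiC_apply (v : Fin 3 → Fin 7 → ℝ) : phiC v = phi0 v := rfl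

/-- The standard frame. -/
noncomputable def stdFrame : Fin 7 → Fin 7 → ℝ := fun i => Pi.single i 1

set_option maxHeartbeats 2000000 in
/-- The infinitesimal action of `gl(7)` on `phi0` hits every 3-form. -/
lemma exists_infinitesimal (c : Fin 7 → Fin 7 → Fin 7 → ℝ) :
    ∃ X : Fin 7 → Fin 7 → ℝ, ∀ i j k : Fin 7, i < j → j < k →
      phi0 ![X i, stdFrame j, stdFrame k] + phi0 ![stdFrame i, X j, stdFrame k]
        + phi0 ![stdFrame i, stdFrame j, X k] = c i j k := by
  refine ⟨![![(1/3)*c 0 1 2 + (1/3)*c 0 3 4 + (1/3)*c 0 5 6 + (-1/6)*c 1 3 5 + (1/6)*c 1 4 6 + (1/6)*c 2 3 6 + (1/6)*c 2 4 5, (1/2)*c 0 3 5 + (-1/2)*c 0 4 6 + (1/2)*c 1 3 4 + (-1/2)*c 1 5 6, (-1/2)*c 0 3 6 + (-1/2)*c 0 4 5 + (1/2)*c 2 3 4 + (-1/2)*c 2 5 6, (-1/2)*c 0 1 5 + (1/2)*c 0 2 6 + (1/2)*c 1 2 3 + (-1/2)*c 3 5 6, (1/2)*c 0 1 6 + (1/2)*c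 0 2 5 + (1/2)*c 1 2 4 + (-1/2)*c 4 5 6, (1/2)*c 0 1 3 + (-1/2)*c 0 2 4 + (1/2)*c 1 2 5 + (1/2)*c 3 4 5, (-1/2)*c 0 1 4 + (-1/2)*c 0 2 3 + (1/2)*c 1 2 6 + (1/2)*c 3 4 6],
   ![(1)*c 1 5 6, (1/3)*c 0 1 2 + (-1/6)*c 0 3 4 + (-1/6)*c 0 5 6 + (1/3)*c 1 3 5 + (-1/3)*c 1 4 6 + (1/6)*c 2 3 6 + (1/6)*c 2 4 5, (-1/2)*c 1 3 6 + (-1/2)*c 1 4 5 + (1/2)*c 2 3 5 + (1/2)*c 2 4 6, (1/2)*c 0 1 4 + (-1/2)*c 0 2 3 + (1/2)*c 1 2 6 + (1/2)*c 3 4 6, (-1/2)*c 0 1 3 + (-1/2)*c 0 2 4 + (1/2)*c 1 2 5 + (-1/2)*c 3 4 5, (1/2)*c 0 1 6 + (-1/2)*c 0 2 5 + (-1/2)*c 1 2 4 + (1/2)*c 4 5 6, (-1/2)*c 0 1 5 + (-1/2)*c 0 2 6 + (-1/2)*c 1 2 3 + (1/2)*c 3 5 6],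
   ![(1)*c 2 5 6, (-1)*c 2 4 6, (1/3)*c 0 1 2 + (-1/6)*c 0 3 4 + (-1/6)*c 0 5 6 + (-1/6)*c 1 3 5 + (1/6)*c 1 4 6 + (-1/3)*c 2 3 6 + (-1/3)*c 2 4 5, (1/2)*c 0 1 3 + (1/2)*c 0 2 4 + (1/2)*c 1 2 5 + (1/2)*c 3 4 5, (1/2)*c 0 1 4 + (-1/2)*c 0 2 3 + (-1/2)*c 1 2 6 + (1/2)*c 3 4 6, (1/2)*c 0 1 5 + (1/2)*c 0 2 6 + (-1/2)*c 1 2 3 + (1/2)*c 3 5 6, (1/2)*c 0 1 6 + (-1/2)*c 0 2 5 + (1/2)*c 1 2 4 + (-1/2)*c 4 5 6],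
   ![(1)*c 3 5 6, (-1)*c 3 4 6, (-1)*c 3 4 5, (-1/6)*c 0 1 2 + (1/3)*c 0 3 4 + (-1/6)*c 0 5 6 + (1/3)*c 1 3 5 + (1/6)*c 1 4 6 + (-1/3)*c 2 3 6 + (1/6)*c 2 4 5, (-1/2)*c 1 3 6 + (1/2)*c 1 4 5 + (-1/2)*c 2 3 5 + (-1/2)*c 2 4 6, (1/2)*c 0 3 6 + (-1/2)*c 0 4 5 + (1/2)*c 2 3 4 + (-1/2)*c 2 5 6, (-1/2)*c 0 3 5 + (-1/2)*c 0 4 6 + (1/2)*c 1 3 4 + (-1/2)*c 1 5 6],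
   ![(1)*c 4 5 6, 0, 0, 0, (-1/6)*c 0 1 2 + (1/3)*c 0 3 4 + (-1/6)*c 0 5 6 + (-1/6)*c 1 3 5 + (-1/3)*c 1 4 6 + (1/6)*c 2 3 6 + (-1/3)*c 2 4 5, (1/2)*c 0 3 5 + (1/2)*c 0 4 6 + (1/2)*c 1 3 4 + (-1/2)*c 1 5 6, (1/2)*c 0 3 6 + (-1/2)*c 0 4 5 + (-1/2)*c 2 3 4 + (1/2)*c 2 5 6],
   ![0, 0, 0, 0, 0, (-1/6)*c 0 1 2 + (-1/6)*c 0 3 4 + (1/3)*c 0 5 6 + (1/3)*c 1 3 5 + (1/6)*c 1 4 6 + (1/6)*c 2 3 6 + (-1/3)*c 2 4 5, (1/2)*c 1 3 6 + (-1/2)*c 1 4 5 + (-1/2)*c 2 3 5 + (-1/2)*c 2 4 6],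
   ![0, 0, 0, 0, 0, 0, (-1/6)*c 0 1 2 + (-1/6)*c 0 3 4 + (1/3)*c 0 5 6 + (-1/6)*c 1 3 5 + (-1/3)*c 1 4 6 + (-1/3)*c 2 3 6 + (1/6)*c 2 4 5]], ?_⟩
  intro i j k hij hjk
  fin_cases i <;> fin_cases j <;> first
    | (exfalso; revert hij; decide)
    | (fin_cases k <;> first
        | (exfalso; revert hjk; decide)
        | (simp [phi0, eForm_apply, stdFrame]; try ring))

/-- The orbit map in coordinates: a frame is sent to the coefficients of the pulled back form. -/
noncomputable def orbitMap (A : Fin 7 → Fin 7 → ℝ) : (Fin 3 ↪o Fin 7) → ℝ :=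
  fun v => phiC (fun t => A (v t))

/-- Selecting three vectors of a frame. -/
noncomputable def pick (v : Fin 3 ↪o Fin 7) : (Fin 7 → Fin 7 → ℝ) →L[ℝ] (Fin 3 → Fin 7 → ℝ) :=
  ContinuousLinearMap.pi fun t => ContinuousLinearMap.proj (v t)

/-- Derivative of the orbit map. -/
noncomputable def orbitDeriv : (Fin 7 → Fin 7 → ℝ) →L[ℝ] ((Fin 3 ↪o Fin 7) → ℝ) :=
  ContinuousLinearMap.pi fun v => (phiC.linearDeriv (pick v stdFrame)).comp (pick v)

lemma orbitMap_hasStrictFDerivAt : HasStrictFDerivAt orbitMap orbitDeriv stdFrame := by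
  rw [hasStrictFDerivAt_pi']
  intro v
  exact (phiC.hasStrictFDerivAt (pick v stdFrame)).comp stdFrame (pick v).hasStrictFDerivAt

lemma orbitDeriv_range : orbitDeriv.range = ⊤ := by
  rw [LinearMap.range_eq_top]
  intro c
  obtain ⟨X, hX⟩ := exists_infinitesimal
    (fun i j k => if h : StrictMono ![i, j, k] then c (OrderEmbedding.ofStrictMono _ h) else 0)
  refine ⟨X, ?_⟩
  funext v
  have hv : ![v 0, v 1, v 2] = v := by
    funext t; fin_cases t <;> rfl
  have h := hX (v 0) (v 1) (v 2) (v.strictMono (by decide)) (v.strictMono (by decide))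
  have hs : StrictMono ![v 0, v 1, v 2] := by rw [hv]; exact v.strictMono
  rw [dif_pos hs] at h
  have hv' : OrderEmbedding.ofStrictMono _ hs = v := by
    ext t; simp [hv]
  rw [hv'] at h
  rw [← h]
  change phiC.linearDeriv (pick v stdFrame) (pick v X) = _
  rw [ContinuousMultilinearMap.linearDeriv_apply, Fin.sum_univ_three]
  simp only [phiC_apply]
  refine congrArg₂ (· + ·) (congrArg₂ (· + ·) ?_ ?_) ?_
  all_goals
    refine congrArg phi0 ?_
    funext t
    fin_cases t <;> simp [pick]

/-- Alternating maps agreeing on increasing triples of basis vectors are equal. -/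
lemma alternating_ext_increasing {f g : AlternatingMap ℝ (Fin 7 → ℝ) ℝ (Fin 3)}
    (h : ∀ v : Fin 3 ↪o Fin 7, f (fun t => stdFrame (v t)) = g (fun t => stdFrame (v t))) :
    f = g := by
  refine Module.Basis.ext_alternating (Pi.basisFun ℝ (Fin 7)) fun v hv => ?_
  have hs : StrictMono (v ∘ Tuple.sort v) :=
    (Tuple.monotone_sort v).strictMono_of_injective (hv.comp (Tuple.sort v).injective)
  have h1 := h (OrderEmbedding.ofStrictMono _ hs)
  have h2 : ∀ f : AlternatingMap ℝ (Fin 7 → ℝ) ℝ (Fin 3),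
      f (fun t => stdFrame (OrderEmbedding.ofStrictMono _ hs t)) =
        Equiv.Perm.sign (Tuple.sort v) • f (fun t => Pi.basisFun ℝ (Fin 7) (v t)) := by
    intro f
    rw [← AlternatingMap.map_perm]
    congr 1
    funext t
    simp [stdFrame]
  rw [h2, h2] at h1
  exact smul_left_cancel _ h1


/-- There is `m > 0` such that every alternating 3-form `ψ` on `ℝ⁷` with `‖ψ − φ₀‖ < m`
(for the sup-norm of the coefficients in the standard basis) lies in the `GL(7,ℝ)`-orbit
of `φ₀`: there is a linear automorphism `g` of `ℝ⁷` with
`ψ(v₁,v₂,v₃) = φ₀(g v₁, g v₂, g v₃)` for all `v₁, v₂, v₃`. -/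
theorem orbit_of_phi0_is_neighborhood :
    ∃ m : ℝ, 0 < m ∧
      ∀ ψ : AlternatingMap ℝ (Fin 7 → ℝ) ℝ (Fin 3),
        (∀ i j k : Fin 7,
          |ψ (fun t => Pi.single (![i, j, k] t) 1)
            - phi0 (fun t => Pi.single (![i, j, k] t) 1)| < m) →
        ∃ g : (Fin 7 → ℝ) ≃ₗ[ℝ] (Fin 7 → ℝ),
          ∀ v : Fin 3 → (Fin 7 → ℝ), ψ v = phi0 (fun t => g (v t)) := by
  have hU : {A : Fin 7 → Fin 7 → ℝ | (Matrix.of A).det ≠ 0} ∈ nhds stdFrame := by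
    refine IsOpen.mem_nhds ?_ ?_
    · refine isOpen_ne.preimage (Continuous.matrix_det ?_)
      exact continuous_id
    · have : Matrix.of stdFrame = (1 : Matrix (Fin 7) (Fin 7) ℝ) := by
        ext i j; simp [stdFrame, Matrix.one_apply, Pi.single_apply, eq_comm]
      simp [this]
  have hF := orbitMap_hasStrictFDerivAt.map_nhds_eq_of_surj orbitDeriv_range
  have hI := Filter.image_mem_map (m := orbitMap) hU
  rw [hF, Metric.mem_nhds_iff] at hI
  obtain ⟨m, hm, hball⟩ := hI
  refine ⟨m, hm, fun ψ hψ => ?_⟩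
  have hmem : (fun v : Fin 3 ↪o Fin 7 => ψ (fun t => stdFrame (v t)))
      ∈ Metric.ball (orbitMap stdFrame) m := by
    rw [Metric.mem_ball, dist_pi_lt_iff hm]
    intro v
    have h := hψ (v 0) (v 1) (v 2)
    have hv : ![v 0, v 1, v 2] = v := by
      funext t; fin_cases t <;> rfl
    rw [hv] at h
    rw [Real.dist_eq]
    exact h
  obtain ⟨A, hA, hAψ⟩ := hball hmem
  let g : (Fin 7 → ℝ) ≃ₗ[ℝ] (Fin 7 → ℝ) :=
    Matrix.toLinearEquiv' (Matrix.of A).transpose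
      (Matrix.invertibleOfIsUnitDet _ (by
        rw [Matrix.det_transpose]; exact isUnit_iff_ne_zero.mpr hA))
  have hg : ∀ i, g (stdFrame i) = A i := by
    intro i
    change (Matrix.of A).transpose.toLin' (stdFrame i) = A i
    funext j
    simp [stdFrame]
  have key : ψ = phi0.compLinearMap g.toLinearMap := by
    apply alternating_ext_increasing
    intro v
    have := congrFun hAψ v
    simp only [orbitMap, phiC_apply] at this
    rw [← this, AlternatingMap.compLinearMap_apply]
    congr 1
    funext t
    exact (hg _).symm
  refine ⟨g, fun v => ?_⟩
  conv_lhs => rw [key]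
  rfl
end

section
/- Let N be a set and F : N ≃ N a bijection. Let M be the quotient of ℝ × N by the equivalence (t,p) ∼ (t+n, Fⁿ(p)) for n ∈ ℤ, with projection q and classes written [t,p]. (i) If ξ : N → N satisfies ξ∘F = F∘ξ, then ι[t,p] := [t, ξ(p)] is well defined on M, and the fixed-point set of ι equals q(ℝ × Fix(ξ)). (ii) If η : N → N satisfies η∘F = F⁻¹∘η, then κ[t,p] := [1−t, η(p)] is well defined on M, and the fixed-point set of κ equals q({0} × Fix(η∘F)) ∪ q({1/2} × Fix(η)). -/
/-- The mapping-torus relation on `ℝ × N` determined by a bijection `F : N ≃ N`: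
`(t, p) ∼ (t + n, Fⁿ p)` for `n : ℤ`. -/
def mappingTorusRel {N : Type*} (F : Equiv.Perm N) (x y : ℝ × N) : Prop :=
  ∃ n : ℤ, y.1 = x.1 + n ∧ y.2 = (F ^ n) x.2

theorem mt_equiv {N : Type*} (F : Equiv.Perm N) : Equivalence (mappingTorusRel F) := by
  refine ⟨fun x => ⟨0, by simp, by simp⟩, ?_, ?_⟩
  · rintro x y ⟨n, h1, h2⟩
    refine ⟨-n, by rw [h1]; push_cast; ring, ?_⟩
    rw [h2, ← Equiv.Perm.mul_apply, ← zpow_add]; simp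
  · rintro x y z ⟨n, h1, h2⟩ ⟨m, h3, h4⟩
    refine ⟨m + n, by rw [h3, h1]; push_cast; ring, ?_⟩
    rw [h4, h2, ← Equiv.Perm.mul_apply, ← zpow_add]

theorem mt_exact {N : Type*} (F : Equiv.Perm N) (x y : ℝ × N) :
    Quot.mk (mappingTorusRel F) x = Quot.mk (mappingTorusRel F) y ↔ mappingTorusRel F x y := by
  rw [Quot.eq, (mt_equiv F).eqvGen_iff]

theorem mt_zpow {N : Type*} (F G : Equiv.Perm N) (f : N → N)
    (h : ∀ p, f (F p) = G (f p)) (n : ℤ) (p : N) : f ((F ^ n) p) = (G ^ n) (f p) := by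
  induction n generalizing p with
  | zero => simp
  | succ n ih =>
    rw [zpow_add_one, zpow_add_one, Equiv.Perm.mul_apply, Equiv.Perm.mul_apply, ih, h]
  | pred n ih =>
    rw [zpow_sub_one, zpow_sub_one, Equiv.Perm.mul_apply, Equiv.Perm.mul_apply, ih]
    congr 1
    rw [Equiv.Perm.eq_inv_iff_eq, ← h]; simp

theorem mappingTorus_involutions {N : Type*} (F : Equiv.Perm N) :
    -- (i) if ξ ∘ F = F ∘ ξ, then ι[t,p] = [t, ξ p] is well defined and
    --     Fix ι = q(ℝ × Fix ξ)
    (∀ ξ : N → N, ξ ∘ F = F ∘ ξ →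
      ∃ ι : Quot (mappingTorusRel F) → Quot (mappingTorusRel F),
        (∀ (t : ℝ) (p : N), ι (Quot.mk (mappingTorusRel F) (t, p)) =
            Quot.mk (mappingTorusRel F) (t, ξ p)) ∧
        {x | ι x = x} = Quot.mk (mappingTorusRel F) '' {tp : ℝ × N | ξ tp.2 = tp.2}) ∧
    -- (ii) if η ∘ F = F⁻¹ ∘ η, then κ[t,p] = [1−t, η p] is well defined and
    --      Fix κ = q({0} × Fix (η ∘ F)) ∪ q({1/2} × Fix η)
    (∀ η : N → N, η ∘ F = F.symm ∘ η →
      ∃ κ : Quot (mappingTorusRel F) → Quot (mappingTorusRel F),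
        (∀ (t : ℝ) (p : N), κ (Quot.mk (mappingTorusRel F) (t, p)) =
            Quot.mk (mappingTorusRel F) (1 - t, η p)) ∧
        {x | κ x = x} =
          Quot.mk (mappingTorusRel F) '' {tp : ℝ × N | tp.1 = 0 ∧ η (F tp.2) = tp.2} ∪
          Quot.mk (mappingTorusRel F) '' {tp : ℝ × N | tp.1 = 1 / 2 ∧ η tp.2 = tp.2}) := by
  constructor
  · intro ξ hξ
    have hz := mt_zpow F F ξ (fun p => congrFun hξ p)
    refine ⟨Quot.map (fun x => (x.1, ξ x.2)) ?_, fun t p => rfl, ?_⟩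
    · rintro x y ⟨n, h1, h2⟩
      exact ⟨n, h1, by simp only [h2, hz]⟩
    · ext x
      constructor
      · induction x using Quot.ind with | mk x => ?_
        intro h
        obtain ⟨n, h1, h2⟩ := (mt_exact F _ _).1 h
        have hn : n = 0 := by simpa using h1
        subst hn
        exact ⟨x, by simpa using h2.symm, rfl⟩
      · rintro ⟨x, hx, rfl⟩
        exact congrArg (Quot.mk _) (Prod.ext rfl hx)
  · intro η hη
    have hz : ∀ (n : ℤ) (p : N), η ((F ^ n) p) = (F ^ (-n)) (η p) := by
      intro n p
      rw [mt_zpow F F⁻¹ η (fun p => congrFun hη p), inv_zpow']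
    refine ⟨Quot.map (fun x => (1 - x.1, η x.2)) ?_, fun t p => rfl, ?_⟩
    · rintro x y ⟨n, h1, h2⟩
      exact ⟨-n, by simp only [h1]; push_cast; ring, by simp only [h2, hz]⟩
    · ext x
      constructor
      · induction x using Quot.ind with | mk x => ?_
        intro h
        obtain ⟨n, h1, h2⟩ := (mt_exact F _ _).1 h
        obtain ⟨t, p⟩ := x
        simp only at h1 h2
        have h3 : η p = (F ^ (-n)) p := by
          conv_rhs => rw [h2]
          rw [← Equiv.Perm.mul_apply, ← zpow_add]; simp
        rcases Int.even_or_odd' n with ⟨k, rfl | rfl⟩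
        · right
          refine ⟨(1 / 2, (F ^ (-k)) p), ⟨rfl, ?_⟩, ?_⟩
          · simp only
            rw [hz, h3, ← Equiv.Perm.mul_apply, ← zpow_add]
            congr 2; ring
          · refine (mt_exact F _ _).2 ⟨k, ?_, ?_⟩
            · push_cast at h1 ⊢; linarith
            · simp only
              rw [← Equiv.Perm.mul_apply, ← zpow_add]; simp
        · left
          refine ⟨(0, (F ^ (-(k + 1))) p), ⟨rfl, ?_⟩, ?_⟩
          · simp only
            rw [← Equiv.Perm.mul_apply, ← zpow_one_add, hz, h3, ← Equiv.Perm.mul_apply, ← zpow_add]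
            congr 2; ring
          · refine (mt_exact F _ _).2 ⟨k + 1, ?_, ?_⟩
            · push_cast at h1 ⊢; linarith
            · simp only
              rw [← Equiv.Perm.mul_apply, ← zpow_add]; simp
      · rintro (⟨⟨t, p⟩, ⟨h1, h2⟩, rfl⟩ | ⟨⟨t, p⟩, ⟨h1, h2⟩, rfl⟩)
        · simp only at h1 h2
          subst h1
          refine (mt_exact F _ _).2 ⟨-1, by norm_num, ?_⟩
          have := hz 1 p
          rw [zpow_one, h2] at this
          exact this
        · simp only at h1 h2
          subst h1
          exact congrArg (Quot.mk _) (Prod.ext (by norm_num) h2)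
end

section
/- Let Γ₁ = ℤ + ℤω ⊂ ℂ with ω = exp(2πi/3), and let Φ : Γ₁³ → Γ₁³ be the additive group homomorphism Φ(z₁,z₂,z₃) = (ωz₁ − z₁, ωz₂ − ωz₁ − z₂, ωz₃ − z₃) (well defined since ωΓ₁ = Γ₁). Then the quotient group Γ₁³ / Φ(Γ₁³) is isomorphic to (ℤ/3ℤ)³. -/
/-- The primitive cube root of unity `ω = exp(2πi/3)`. -/
noncomputable def ω₀ : ℂ := Complex.exp (2 * Real.pi * Complex.I / 3)

/-- The Eisenstein lattice `Γ₁ = ℤ + ℤω ⊂ ℂ`. -/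
noncomputable def Γ₁ : AddSubgroup ℂ := AddSubgroup.closure {1, ω₀}

lemma omega_sq : ω₀ * ω₀ = -1 - ω₀ := by
  have h3 : IsPrimitiveRoot ω₀ 3 := by
    have := Complex.isPrimitiveRoot_exp 3 (by norm_num)
    simpa [ω₀] using this
  have h1 : ω₀ ^ 3 = 1 := h3.pow_eq_one
  have hne : ω₀ - 1 ≠ 0 := sub_ne_zero.mpr (h3.ne_one (by norm_num))
  have : (ω₀ - 1) * (ω₀ * ω₀ + 1 + ω₀) = 0 := by linear_combination h1
  rcases mul_eq_zero.mp this with h | h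
  · exact absurd h hne
  · linear_combination h

lemma omega_im : ω₀.im ≠ 0 := by
  intro h
  have h2 := congrArg Complex.re omega_sq
  simp [h] at h2
  nlinarith [sq_nonneg (ω₀.re + 1 / 2)]

/-- The map `(a, b) ↦ a + bω`. -/
noncomputable def eisMap : ℤ × ℤ →+ ℂ where
  toFun p := (p.1 : ℂ) + (p.2 : ℂ) * ω₀
  map_zero' := by simp
  map_add' p q := by simp; ring

lemma eisMap_inj : Function.Injective eisMap := by
  rw [injective_iff_map_eq_zero]
  rintro ⟨a, b⟩ h
  have h : (a : ℂ) + (b : ℂ) * ω₀ = 0 := h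
  have him := congrArg Complex.im h
  simp [omega_im] at him
  subst him
  simp at h
  simp [h]

lemma eisMap_range : eisMap.range = Γ₁ := by
  apply le_antisymm
  · rintro _ ⟨⟨a, b⟩, rfl⟩
    change (a : ℂ) + (b : ℂ) * ω₀ ∈ Γ₁
    have h1 : (1 : ℂ) ∈ Γ₁ := AddSubgroup.subset_closure (by simp)
    have h2 : ω₀ ∈ Γ₁ := AddSubgroup.subset_closure (by simp)
    have := Γ₁.add_mem (Γ₁.zsmul_mem h1 a) (Γ₁.zsmul_mem h2 b)
    simpa using this
  · refine (AddSubgroup.closure_le _).mpr ?_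
    rintro x (rfl | rfl)
    · exact ⟨(1, 0), by simp [eisMap]⟩
    · exact ⟨(0, 1), by simp [eisMap]⟩

lemma exists_coords : ∃ e : Γ₁ ≃+ ℤ × ℤ,
    ∀ z : Γ₁, (z : ℂ) = ((e z).1 : ℂ) + ((e z).2 : ℂ) * ω₀ := by
  let e := (AddMonoidHom.ofInjective eisMap_inj).trans (AddEquiv.addSubgroupCongr eisMap_range)
  refine ⟨e.symm, fun z => ?_⟩
  obtain ⟨p, rfl⟩ := e.surjective z
  rw [e.symm_apply_apply]
  rfl

lemma coords_unique {a b c d : ℤ} (h : (a : ℂ) + (b : ℂ) * ω₀ = (c : ℂ) + (d : ℂ) * ω₀) :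
    a = c ∧ b = d := by
  have := @eisMap_inj (a, b) (c, d) h
  simpa using this

/-- The quotient map in coordinates. -/
def quotMap : (ℤ × ℤ) × (ℤ × ℤ) × (ℤ × ℤ) →+ ZMod 3 × ZMod 3 × ZMod 3 where
  toFun w := (((w.1.1 + 2 * w.2.1.1 - w.2.1.2 : ℤ) : ZMod 3),
    ((w.1.2 + w.2.1.1 + w.2.1.2 : ℤ) : ZMod 3), ((w.2.2.1 + w.2.2.2 : ℤ) : ZMod 3))
  map_zero' := by simp
  map_add' p q := by
    simp only [Prod.fst_add, Prod.snd_add, Prod.mk_add_mk, Prod.mk.injEq]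
    push_cast
    refine ⟨?_, ?_, ?_⟩ <;> ring

lemma quotMap_surj : Function.Surjective quotMap := by
  rintro ⟨x, y, t⟩
  obtain ⟨a, rfl⟩ := ZMod.intCast_surjective x
  obtain ⟨b, rfl⟩ := ZMod.intCast_surjective y
  obtain ⟨c, rfl⟩ := ZMod.intCast_surjective t
  exact ⟨((a, b), (0, 0), (c, 0)), by simp [quotMap]⟩

lemma quotMap_eq_zero (a b c d f g : ℤ) : quotMap ((a, b), (c, d), (f, g)) = 0 ↔
    (3 ∣ a + 2 * c - d) ∧ (3 ∣ b + c + d) ∧ (3 ∣ f + g) := by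
  have h : ∀ n : ℤ, ((n : ZMod 3) = 0 ↔ 3 ∣ n) := fun n =>
    (ZMod.intCast_zmod_eq_zero_iff_dvd n 3)
  rw [← h, ← h, ← h]
  simp only [quotMap, AddMonoidHom.coe_mk, ZeroHom.coe_mk, Prod.mk_eq_zero]

/-- If `Φ : Γ₁³ → Γ₁³` is the additive homomorphism
`Φ(z₁,z₂,z₃) = (ωz₁ − z₁, ωz₂ − ωz₁ − z₂, ωz₃ − z₃)`, then `Γ₁³ / Φ(Γ₁³) ≅ (ℤ/3ℤ)³`. -/
theorem quotient_by_F13_sub_id (Φ : (Γ₁ × Γ₁ × Γ₁) →+ (Γ₁ × Γ₁ × Γ₁))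
    (hΦ : ∀ z : Γ₁ × Γ₁ × Γ₁,
      ((Φ z).1 : ℂ) = ω₀ * (z.1 : ℂ) - (z.1 : ℂ) ∧
      ((Φ z).2.1 : ℂ) = ω₀ * (z.2.1 : ℂ) - ω₀ * (z.1 : ℂ) - (z.2.1 : ℂ) ∧
      ((Φ z).2.2 : ℂ) = ω₀ * (z.2.2 : ℂ) - (z.2.2 : ℂ)) :
    Nonempty (((Γ₁ × Γ₁ × Γ₁) ⧸ Φ.range) ≃+ (ZMod 3 × ZMod 3 × ZMod 3)) := by
  obtain ⟨e, he⟩ := exists_coords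
  have hsq := omega_sq
  let E : (Γ₁ × Γ₁ × Γ₁) ≃+ (ℤ × ℤ) × (ℤ × ℤ) × (ℤ × ℤ) := e.prodCongr (e.prodCongr e)
  let ψ := quotMap.comp E.toAddMonoidHom
  have hψ : Function.Surjective ψ := quotMap_surj.comp E.surjective
  -- the map in coordinates
  have key : ∀ p q r s u v : ℤ, E (Φ (E.symm ((p, q), (r, s), (u, v)))) =
      ((-p - q, p - 2 * q), (-r - s + q, r - 2 * s - p + q), (-u - v, u - 2 * v)) := by
    intro p q r s u v
    have hz' : E (E.symm ((p, q), (r, s), (u, v))) = ((p, q), (r, s), (u, v)) :=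
      E.apply_symm_apply _
    generalize E.symm ((p, q), (r, s), (u, v)) = z at hz'
    obtain ⟨z1, z2, z3⟩ := z
    have e1 : e z1 = (p, q) := congrArg (fun t => t.1) hz'
    have e2 : e z2 = (r, s) := congrArg (fun t => t.2.1) hz'
    have e3 : e z3 = (u, v) := congrArg (fun t => t.2.2) hz'
    obtain ⟨h1, h2, h3⟩ := hΦ (z1, z2, z3)
    generalize Φ (z1, z2, z3) = w at h1 h2 h3
    obtain ⟨w1, w2, w3⟩ := w
    simp only at h1 h2 h3
    rw [he w1, he z1, e1] at h1
    rw [he w2, he z1, he z2, e1, e2] at h2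
    rw [he w3, he z3, e3] at h3
    have k1 : e w1 = (-p - q, p - 2 * q) := Prod.ext_iff.mpr (coords_unique (by
      push_cast; linear_combination h1 + q * hsq))
    have k2 : e w2 = (-r - s + q, r - 2 * s - p + q) := Prod.ext_iff.mpr (coords_unique (by
      push_cast; linear_combination h2 + (s - q) * hsq))
    have k3 : e w3 = (-u - v, u - 2 * v) := Prod.ext_iff.mpr (coords_unique (by
      push_cast; linear_combination h3 + v * hsq))
    change (e w1, e w2, e w3) = _
    rw [k1, k2, k3]
  have hker : Φ.range = ψ.ker := by
    ext w
    rw [AddMonoidHom.mem_ker]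
    constructor
    · rintro ⟨z, rfl⟩
      obtain ⟨⟨⟨p, q⟩, ⟨r, s⟩, ⟨u, v⟩⟩, rfl⟩ := E.symm.surjective z
      change quotMap (E (Φ _)) = 0
      rw [key, quotMap_eq_zero]
      refine ⟨?_, ?_, ?_⟩ <;> omega
    · intro hw
      change quotMap (E w) = 0 at hw
      obtain ⟨⟨⟨a, b⟩, ⟨c, d⟩, ⟨f, g⟩⟩, rfl⟩ := E.symm.surjective w
      rw [E.apply_symm_apply, quotMap_eq_zero] at hw
      obtain ⟨⟨k, hk⟩, ⟨l, hl⟩, ⟨m, hm⟩⟩ := hw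
      refine ⟨E.symm ((c - d - 2 * k + l, c - k - l), (-k, -l), (-f + m, -m)), ?_⟩
      apply E.injective
      rw [key, E.apply_symm_apply]
      simp only [Prod.mk.injEq]
      refine ⟨⟨?_, ?_⟩, ⟨?_, ?_⟩, ?_, ?_⟩ <;> omega
  exact ⟨(QuotientAddGroup.quotientAddEquivOfEq hker).trans
    (QuotientAddGroup.quotientKerEquivOfSurjective ψ hψ)⟩
end

section
/- Let Γ₂ = ℤ + ℤi ⊂ ℂ, and let Φ : Γ₂³ → Γ₂³ be the additive group homomorphism Φ(z₁,z₂,z₃) = (iz₁ − z₁, iz₂ − iz₁ − z₂, −2z₃) (well defined since iΓ₂ = Γ₂). Then the quotient group Γ₂³ / Φ(Γ₂³) is isomorphic to (ℤ/2ℤ)⁴. -/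
/-- The Gaussian lattice `Γ₂ = ℤ + ℤi ⊂ ℂ`. -/
noncomputable def Γ₂ : AddSubgroup ℂ := AddSubgroup.closure {1, Complex.I}

theorem mem_G2_iff (x : ℂ) : x ∈ Γ₂ ↔ ∃ a b : ℤ, x = a + b * Complex.I := by
  unfold Γ₂
  rw [AddSubgroup.mem_closure_pair]
  simp only [zsmul_eq_mul, mul_one, eq_comm]

theorem G2_coord (x : Γ₂) : ((⌊(x : ℂ).re⌋ : ℤ) : ℝ) = (x : ℂ).re ∧
    ((⌊(x : ℂ).im⌋ : ℤ) : ℝ) = (x : ℂ).im := by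
  obtain ⟨x, hx⟩ := x
  obtain ⟨a, b, rfl⟩ := (mem_G2_iff x).1 hx
  simp

/-- Integer real part. -/
noncomputable def G2re : Γ₂ →+ ℤ :=
  AddMonoidHom.mk' (fun x => ⌊(x : ℂ).re⌋) (by
    intro x y
    have h1 := (G2_coord x).1
    have h2 := (G2_coord y).1
    have h3 := (G2_coord (x + y)).1
    apply Int.cast_injective (α := ℝ)
    beta_reduce
    rw [Int.cast_add, h1, h2, h3, AddSubgroup.coe_add, Complex.add_re])

/-- Integer imaginary part. -/
noncomputable def G2im : Γ₂ →+ ℤ :=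
  AddMonoidHom.mk' (fun x => ⌊(x : ℂ).im⌋) (by
    intro x y
    have h1 := (G2_coord x).2
    have h2 := (G2_coord y).2
    have h3 := (G2_coord (x + y)).2
    apply Int.cast_injective (α := ℝ)
    beta_reduce
    rw [Int.cast_add, h1, h2, h3, AddSubgroup.coe_add, Complex.add_im])

theorem G2re_cast (x : Γ₂) : ((G2re x : ℤ) : ℝ) = (x : ℂ).re := (G2_coord x).1
theorem G2im_cast (x : Γ₂) : ((G2im x : ℤ) : ℝ) = (x : ℂ).im := (G2_coord x).2

/-- The lattice point with given coordinates. -/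
noncomputable def G2mk (a b : ℤ) : Γ₂ := ⟨a + b * Complex.I, (mem_G2_iff _).2 ⟨a, b, rfl⟩⟩

theorem G2re_mk (a b : ℤ) : G2re (G2mk a b) = a := by
  have := G2re_cast (G2mk a b)
  simp [G2mk] at this
  exact_mod_cast this

theorem G2im_mk (a b : ℤ) : G2im (G2mk a b) = b := by
  have := G2im_cast (G2mk a b)
  simp [G2mk] at this
  exact_mod_cast this

theorem G2_ext {x y : Γ₂} (h1 : G2re x = G2re y) (h2 : G2im x = G2im y) : x = y := by
  apply Subtype.ext
  apply Complex.ext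
  · rw [← G2re_cast, ← G2re_cast, h1]
  · rw [← G2im_cast, ← G2im_cast, h2]

/-- The invariants of the quotient: `i w₁ + (i - 1) w₂` and `w₃` modulo 2. -/
noncomputable def G2inv : (Γ₂ × Γ₂ × Γ₂) →+ (ZMod 2 × ZMod 2 × ZMod 2 × ZMod 2) :=
  AddMonoidHom.mk' (fun w =>
    (((G2im w.1 + G2re w.2.1 + G2im w.2.1 : ℤ) : ZMod 2),
     ((G2re w.1 + G2re w.2.1 + G2im w.2.1 : ℤ) : ZMod 2),
     ((G2re w.2.2 : ℤ) : ZMod 2), ((G2im w.2.2 : ℤ) : ZMod 2))) (by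
    intro x y
    ext <;> simp <;> ring)

/-- If `Φ : Γ₂³ → Γ₂³` is the additive homomorphism
`Φ(z₁,z₂,z₃) = (iz₁ − z₁, iz₂ − iz₁ − z₂, −2z₃)`, then `Γ₂³ / Φ(Γ₂³) ≅ (ℤ/2ℤ)⁴`. -/
theorem quotient_by_F24_sub_id (Φ : (Γ₂ × Γ₂ × Γ₂) →+ (Γ₂ × Γ₂ × Γ₂))
    (hΦ : ∀ z : Γ₂ × Γ₂ × Γ₂,
      ((Φ z).1 : ℂ) = Complex.I * (z.1 : ℂ) - (z.1 : ℂ) ∧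
      ((Φ z).2.1 : ℂ) = Complex.I * (z.2.1 : ℂ) - Complex.I * (z.1 : ℂ) - (z.2.1 : ℂ) ∧
      ((Φ z).2.2 : ℂ) = -2 * (z.2.2 : ℂ)) :
    Nonempty (((Γ₂ × Γ₂ × Γ₂) ⧸ Φ.range) ≃+ (ZMod 2 × ZMod 2 × ZMod 2 × ZMod 2)) := by
  have key : ∀ z : Γ₂ × Γ₂ × Γ₂,
      G2re (Φ z).1 = - G2re z.1 - G2im z.1 ∧ G2im (Φ z).1 = G2re z.1 - G2im z.1 ∧
      G2re (Φ z).2.1 = - G2im z.2.1 + G2im z.1 - G2re z.2.1 ∧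
      G2im (Φ z).2.1 = G2re z.2.1 - G2re z.1 - G2im z.2.1 ∧
      G2re (Φ z).2.2 = -2 * G2re z.2.2 ∧ G2im (Φ z).2.2 = -2 * G2im z.2.2 := by
    intro z
    obtain ⟨h1, h2, h3⟩ := hΦ z
    refine ⟨?_, ?_, ?_, ?_, ?_, ?_⟩ <;> apply Int.cast_injective (α := ℝ) <;> push_cast <;>
      simp only [G2re_cast, G2im_cast, h1, h2, h3] <;> simp <;> ring
  have hker : G2inv.ker = Φ.range := by
    ext w
    have hw : w ∈ G2inv.ker ↔ (2 ∣ G2im w.1 + G2re w.2.1 + G2im w.2.1 ∧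
        2 ∣ G2re w.1 + G2re w.2.1 + G2im w.2.1 ∧ 2 ∣ G2re w.2.2 ∧ 2 ∣ G2im w.2.2) := by
      have e : ∀ n : ℤ, ((n : ℤ) : ZMod 2) = 0 ↔ 2 ∣ n := fun n => by
        simpa using ZMod.intCast_zmod_eq_zero_iff_dvd n 2
      rw [AddMonoidHom.mem_ker, ← e, ← e, ← e, ← e]
      simp only [G2inv, AddMonoidHom.mk'_apply, Prod.mk_eq_zero]
    rw [hw, AddMonoidHom.mem_range]
    constructor
    · rintro ⟨h1, h2, h3, h4⟩
      refine ⟨(G2mk ((G2im w.1 - G2re w.1) / 2) (-((G2re w.1 + G2im w.1) / 2)),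
        G2mk ((G2im w.2.1 - G2re w.2.1 - G2re w.1) / 2)
          (-((G2re w.2.1 + G2im w.2.1 + G2im w.1) / 2)),
        G2mk (-(G2re w.2.2 / 2)) (-(G2im w.2.2 / 2))), ?_⟩
      generalize hz : (G2mk ((G2im w.1 - G2re w.1) / 2) (-((G2re w.1 + G2im w.1) / 2)),
        G2mk ((G2im w.2.1 - G2re w.2.1 - G2re w.1) / 2)
          (-((G2re w.2.1 + G2im w.2.1 + G2im w.1) / 2)),
        G2mk (-(G2re w.2.2 / 2)) (-(G2im w.2.2 / 2))) = z
      obtain ⟨k1, k2, k3, k4, k5, k6⟩ := key z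
      subst hz
      simp only [G2re_mk, G2im_mk] at k1 k2 k3 k4 k5 k6
      refine Prod.ext (G2_ext ?_ ?_) (Prod.ext (G2_ext ?_ ?_) (G2_ext ?_ ?_))
      · rw [k1]; omega
      · rw [k2]; omega
      · rw [k3]; omega
      · rw [k4]; omega
      · rw [k5]; omega
      · rw [k6]; omega
    · rintro ⟨z, rfl⟩
      obtain ⟨k1, k2, k3, k4, k5, k6⟩ := key z
      rw [k1, k2, k3, k4, k5, k6]
      omega
  have hsurj : Function.Surjective G2inv := by
    rintro ⟨a, b, c, d⟩
    obtain ⟨a, rfl⟩ := ZMod.intCast_surjective a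
    obtain ⟨b, rfl⟩ := ZMod.intCast_surjective b
    obtain ⟨c, rfl⟩ := ZMod.intCast_surjective c
    obtain ⟨d, rfl⟩ := ZMod.intCast_surjective d
    refine ⟨(G2mk b a, 0, G2mk c d), ?_⟩
    simp [G2inv, G2re_mk, G2im_mk]
  rw [← hker]
  exact ⟨QuotientAddGroup.quotientKerEquivOfSurjective G2inv hsurj⟩
end

section
/- Let Γ be an additive subgroup of ℂ closed under complex conjugation, and let g : (ℂ/Γ)³ → (ℂ/Γ)³ be the map induced by z = (z₁,z₂,z₃) ↦ (z̄₁, −z̄₂ − z̄₁, −z̄₃) (well defined since conjugation preserves Γ). Then the class of (z₁,z₂,z₃) is a fixed point of g if and only if z₁ + z₂ + z̄₂ ∈ Γ and z₃ + z̄₃ ∈ Γ (i.e. z₁ ≡ −2·Re(z₂) and 2·Re(z₃) ≡ 0 modulo Γ). -/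
/-- Let `Γ ⊂ ℂ` be an additive subgroup closed under complex conjugation, and let
`g : (ℂ/Γ)³ → (ℂ/Γ)³` be induced by `z ↦ (z̄₁, −z̄₂ − z̄₁, −z̄₃)`. The class of
`(z₁,z₂,z₃)` is fixed by `g` iff `z₁ + z₂ + z̄₂ ∈ Γ` and `z₃ + z̄₃ ∈ Γ`. -/
theorem fixed_points_xi_eta (Γ : AddSubgroup ℂ) (hΓ : ∀ z ∈ Γ, star z ∈ Γ)
    (z₁ z₂ z₃ : ℂ) :
    ((QuotientAddGroup.mk (star z₁) : ℂ ⧸ Γ),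
      (QuotientAddGroup.mk (-(star z₂) - star z₁) : ℂ ⧸ Γ),
      (QuotientAddGroup.mk (-(star z₃)) : ℂ ⧸ Γ)) =
      ((QuotientAddGroup.mk z₁ : ℂ ⧸ Γ), (QuotientAddGroup.mk z₂ : ℂ ⧸ Γ),
        (QuotientAddGroup.mk z₃ : ℂ ⧸ Γ)) ↔
    (z₁ + z₂ + star z₂ ∈ Γ ∧ z₃ + star z₃ ∈ Γ) := by
  rw [Prod.mk.injEq, Prod.mk.injEq, QuotientAddGroup.eq, QuotientAddGroup.eq,
    QuotientAddGroup.eq]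
  constructor
  · rintro ⟨h1, h2, h3⟩
    refine ⟨?_, ?_⟩
    · have h := Γ.add_mem h1 h2
      have e : -star z₁ + z₁ + (-(-star z₂ - star z₁) + z₂) = z₁ + z₂ + star z₂ := by ring
      rwa [e] at h
    · have e : -(-star z₃) + z₃ = z₃ + star z₃ := by ring
      rwa [e] at h3
  · rintro ⟨h, h3⟩
    have hs := hΓ _ h
    rw [star_add, star_add, star_star] at hs
    refine ⟨?_, ?_, ?_⟩
    · have h' := Γ.sub_mem h hs
      have e : z₁ + z₂ + star z₂ - (star z₁ + star z₂ + z₂) = -star z₁ + z₁ := by ring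
      rwa [e] at h'
    · have e : star z₁ + star z₂ + z₂ = -(-star z₂ - star z₁) + z₂ := by ring
      rwa [e] at hs
    · have e : z₃ + star z₃ = -(-star z₃) + z₃ := by ring
      rwa [e] at h3
end

section
/- Let Γ₂ = ℤ + ℤi ⊂ ℂ, and let g : (ℂ/Γ₂)³ → (ℂ/Γ₂)³ be the map induced by z = (z₁,z₂,z₃) ↦ (i·z̄₁, −i·z̄₂, z̄₃) (well defined since multiplication by i and conjugation preserve Γ₂). Then the fixed-point set of g equals { [ (x + xi, y − yi, s + εi) ] : x, y, s ∈ ℝ, ε ∈ {0, 1/2} }, where [·] denotes the class in (ℂ/Γ₂)³. -/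
/-- The projection `ℂ → ℂ/Γ₂`. -/
noncomputable def mk₂ : ℂ → ℂ ⧸ Γ₂ := QuotientAddGroup.mk

theorem mk2_eq_iff (a b : ℂ) :
    mk₂ a = mk₂ b ↔ ∃ m n : ℤ, b.re = a.re + m ∧ b.im = a.im + n := by
  unfold mk₂
  rw [QuotientAddGroup.eq, Γ₂, AddSubgroup.mem_closure_pair]
  constructor
  · rintro ⟨m, n, h⟩
    have h1 := congrArg Complex.re h
    have h2 := congrArg Complex.im h
    simp at h1 h2
    exact ⟨m, n, by linarith, by linarith⟩
  · rintro ⟨m, n, h1, h2⟩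
    refine ⟨m, n, ?_⟩
    apply Complex.ext
    · simp; linarith
    · simp; linarith

/-- The fixed-point set of the map `(ℂ/Γ₂)³ → (ℂ/Γ₂)³` induced by
`z ↦ (i·z̄₁, −i·z̄₂, z̄₃)` equals
`{ [(x+xi, y−yi, s+εi)] : x, y, s ∈ ℝ, ε ∈ {0, 1/2} }`. -/
theorem fixed_points_eta_F24 :
    {w : (ℂ ⧸ Γ₂) × (ℂ ⧸ Γ₂) × (ℂ ⧸ Γ₂) |
      ∃ z₁ z₂ z₃ : ℂ, w = (mk₂ z₁, mk₂ z₂, mk₂ z₃) ∧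
        (mk₂ (Complex.I * star z₁), mk₂ (-Complex.I * star z₂), mk₂ (star z₃)) = w} =
    {w : (ℂ ⧸ Γ₂) × (ℂ ⧸ Γ₂) × (ℂ ⧸ Γ₂) |
      ∃ (x y s ε : ℝ), (ε = 0 ∨ ε = 1 / 2) ∧
        w = (mk₂ (x + x * Complex.I), mk₂ (y - y * Complex.I),
          mk₂ (s + ε * Complex.I))} := by
  ext w
  simp only [Set.mem_setOf_eq]
  constructor
  · rintro ⟨z₁, z₂, z₃, rfl, h⟩
    simp only [Prod.mk.injEq, mk2_eq_iff] at h
    obtain ⟨⟨m1, n1, h1, h1'⟩, ⟨m2, n2, h2, h2'⟩, ⟨m3, n3, h3, h3'⟩⟩ := h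
    simp at h1 h1' h2 h2' h3 h3'
    rcases Int.even_or_odd' n3 with ⟨k, hk | hk⟩
    · refine ⟨z₁.re, z₂.re, z₃.re, 0, Or.inl rfl, ?_⟩
      simp only [Prod.mk.injEq, mk2_eq_iff]
      subst hk
      push_cast at h3'
      refine ⟨⟨0, m1, ?_, ?_⟩, ⟨0, -m2, ?_, ?_⟩, ⟨0, -k, ?_, ?_⟩⟩ <;> simp <;> linarith
    · refine ⟨z₁.re, z₂.re, z₃.re, 1 / 2, Or.inr rfl, ?_⟩
      simp only [Prod.mk.injEq, mk2_eq_iff]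
      subst hk
      push_cast at h3'
      refine ⟨⟨0, m1, ?_, ?_⟩, ⟨0, -m2, ?_, ?_⟩, ⟨0, -k, ?_, ?_⟩⟩ <;> simp <;> linarith
  · rintro ⟨x, y, s, ε, hε, rfl⟩
    refine ⟨_, _, _, rfl, ?_⟩
    simp only [Prod.mk.injEq, mk2_eq_iff]
    rcases hε with rfl | rfl
    · refine ⟨⟨0, 0, ?_, ?_⟩, ⟨0, 0, ?_, ?_⟩, ⟨0, 0, ?_, ?_⟩⟩ <;> simp
    · refine ⟨⟨0, 0, ?_, ?_⟩, ⟨0, 0, ?_, ?_⟩, ⟨0, 1, ?_, ?_⟩⟩ <;> simp <;> norm_num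
end

section
/- Let Γ₂ = ℤ + ℤi ⊂ ℂ. The map (ℂ/Γ₂)³ → (ℂ/Γ₂)³ induced by z ↦ (−z̄₁, z̄₁ + z̄₂, −z̄₃ + i/2) has no fixed points, and the map (ℂ/Γ₂)³ → (ℂ/Γ₂)³ induced by z ↦ (−i·z̄₁, i·z̄₂, z̄₃ + 1/2) has no fixed points. -/
/-- Elements of the Gaussian lattice have integer real and imaginary parts. -/
theorem gauss_int_parts {z : ℂ} (hz : z ∈ Γ₂) :
    (∃ m : ℤ, z.re = m) ∧ (∃ n : ℤ, z.im = n) := by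
  unfold Γ₂ at hz
  induction hz using AddSubgroup.closure_induction with
  | mem x hx =>
    rcases hx with rfl | rfl
    · exact ⟨⟨1, by simp⟩, ⟨0, by simp⟩⟩
    · exact ⟨⟨0, by simp⟩, ⟨1, by simp⟩⟩
  | zero => exact ⟨⟨0, by simp⟩, ⟨0, by simp⟩⟩
  | add x y _ _ hx hy =>
    obtain ⟨⟨a, ha⟩, ⟨b, hb⟩⟩ := hx
    obtain ⟨⟨c, hc⟩, ⟨d, hd⟩⟩ := hy
    exact ⟨⟨a + c, by simp [ha, hc]⟩, ⟨b + d, by simp [hb, hd]⟩⟩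
  | neg x _ hx =>
    obtain ⟨⟨a, ha⟩, ⟨b, hb⟩⟩ := hx
    exact ⟨⟨-a, by simp [ha]⟩, ⟨-b, by simp [hb]⟩⟩

theorem half_not_int (m : ℤ) (h : (m : ℝ) = -(1 / 2)) : False := by
  have h2 : (2 * m : ℝ) = -1 := by linarith
  have h3 : 2 * m = -1 := by exact_mod_cast h2
  omega

/-- The maps of `(ℂ/Γ₂)³` induced by `z ↦ (−z̄₁, z̄₁+z̄₂, −z̄₃+i/2)` and by
`z ↦ (−i·z̄₁, i·z̄₂, z̄₃+1/2)` have no fixed points. -/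
theorem no_fixed_points_zeta_maps :
    (∀ z₁ z₂ z₃ : ℂ,
      (mk₂ (-(star z₁)), mk₂ (star z₁ + star z₂), mk₂ (-(star z₃) + Complex.I / 2)) ≠
        (mk₂ z₁, mk₂ z₂, mk₂ z₃)) ∧
    (∀ z₁ z₂ z₃ : ℂ,
      (mk₂ (-Complex.I * star z₁), mk₂ (Complex.I * star z₂), mk₂ (star z₃ + 1 / 2)) ≠
        (mk₂ z₁, mk₂ z₂, mk₂ z₃)) := by
  constructor
  · intro z₁ z₂ z₃ h
    have h3 : mk₂ (-(star z₃) + Complex.I / 2) = mk₂ z₃ := congrArg (fun p => p.2.2) h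
    obtain ⟨-, n, hn⟩ := gauss_int_parts (QuotientAddGroup.eq.mp h3)
    apply half_not_int n
    rw [← hn]
    simp
  · intro z₁ z₂ z₃ h
    have h3 : mk₂ (star z₃ + 1 / 2) = mk₂ z₃ := congrArg (fun p => p.2.2) h
    obtain ⟨⟨n, hn⟩, -⟩ := gauss_int_parts (QuotientAddGroup.eq.mp h3)
    apply half_not_int n
    rw [← hn]
    simp
end

section
/- For all real numbers y₁, y₂, t satisfying 6π²(y₁² + y₂²)t⁴ < 3√3/8, and for all (λ₁, λ₂, λ₃) ∈ ℝ³ with (λ₁, λ₂, λ₃) ≠ (0,0,0), one has −6λ₁² − 6λ₂² − (3√3/8)λ₃² + 12πt²y₁λ₁λ₃ + 12πt²y₂λ₂λ₃ < 0. -/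
/-- For all reals `y₁ y₂ t` with `6π²(y₁²+y₂²)t⁴ < 3√3/8` and all `(λ₁,λ₂,λ₃) ≠ (0,0,0)`,
`−6λ₁² − 6λ₂² − (3√3/8)λ₃² + 12πt²y₁λ₁λ₃ + 12πt²y₂λ₂λ₃ < 0`. -/
theorem quadratic_form_negative (y₁ y₂ t l₁ l₂ l₃ : ℝ)
    (h : 6 * Real.pi ^ 2 * (y₁ ^ 2 + y₂ ^ 2) * t ^ 4 < 3 * Real.sqrt 3 / 8)
    (hl : (l₁, l₂, l₃) ≠ ((0 : ℝ), (0 : ℝ), (0 : ℝ))) :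
    -6 * l₁ ^ 2 - 6 * l₂ ^ 2 - (3 * Real.sqrt 3 / 8) * l₃ ^ 2
      + 12 * Real.pi * t ^ 2 * y₁ * l₁ * l₃
      + 12 * Real.pi * t ^ 2 * y₂ * l₂ * l₃ < 0 := by
  by_cases h3 : l₃ = 0
  · subst h3
    by_cases h1 : l₁ = 0
    · subst h1
      have h2 : l₂ ≠ 0 := by
        rintro rfl
        exact hl rfl
      have := pow_pos (abs_pos.mpr h2) 2
      rw [sq_abs] at this
      linarith
    · have := pow_pos (abs_pos.mpr h1) 2
      rw [sq_abs] at this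
      have := sq_nonneg l₂
      linarith
  · have hp : 0 < l₃ ^ 2 := by positivity
    have hm := mul_lt_mul_of_pos_right h hp
    have e1 := sq_nonneg (l₁ - Real.pi * t ^ 2 * y₁ * l₃)
    have e2 := sq_nonneg (l₂ - Real.pi * t ^ 2 * y₂ * l₃)
    linarith
end

section
/- Let Γ₁ = ℤ + ℤω ⊂ ℂ with ω = exp(2πi/3), let T = (ℂ/Γ₁)³, let F : T → T be induced by z ↦ (ωz₁, ωz₂ − ωz₁, ωz₃), let M be the mapping torus of F, let κ : M → M be κ[t,x] = [1−t, η(x)] with η : T → T induced by z ↦ (−z̄₁, z̄₂ + z̄₁, −z̄₃), and let X = M/κ be the quotient topological space. Then X is path-connected and its fundamental group is isomorphic to ℤ/3ℤ. -/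
/-- The torus `T = (ℂ/Γ₁)³`. -/
abbrev T₁ : Type := (ℂ ⧸ Γ₁) × (ℂ ⧸ Γ₁) × (ℂ ⧸ Γ₁)

/-- The projection `ℂ → ℂ/Γ₁`. -/
noncomputable def mk₁ : ℂ → ℂ ⧸ Γ₁ := QuotientAddGroup.mk

/-- The mapping-torus relation on `ℝ × T` generated by `(t, x) ∼ (t + 1, F x)`;
its generated equivalence is the ℤ-action `n·(t,x) = (t+n, Fⁿ x)` since `F` is bijective. -/
def mtRel (F : T₁ → T₁) (x y : ℝ × T₁) : Prop := y = (x.1 + 1, F x.2)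


namespace X131

section General
open Path unitInterval
variable {E Y : Type*} [NormedAddCommGroup E] [NormedSpace ℝ E] [TopologicalSpace Y]

/-- Homotopy classes of paths that are constant. -/
inductive IsTriv : ∀ {a b : Y}, Path.Homotopic.Quotient a b → Prop
  | refl (a : Y) : IsTriv (Homotopic.Quotient.refl a)

theorem IsTriv.trans {a b c : Y} {α : Homotopic.Quotient a b} {β : Homotopic.Quotient b c}
    (h : IsTriv α) (h' : IsTriv β) : IsTriv (α.trans β) := by
  cases h; cases h'
  simpa using IsTriv.refl _

theorem IsTriv.symm {a b : Y} {α : Homotopic.Quotient a b}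
    (h : IsTriv α) : IsTriv (α.symm) := by
  cases h
  have : (Homotopic.Quotient.refl a).symm = Homotopic.Quotient.refl a := by
    rw [← Homotopic.Quotient.mk_refl, ← Homotopic.Quotient.mk_symm, Path.refl_symm]
  rw [this]
  exact IsTriv.refl _

theorem IsTriv.trans_right {a b c : Y} {α : Homotopic.Quotient a b} {β : Homotopic.Quotient b c}
    (h' : IsTriv β) : ∃ h : c = b, α.trans β = α.cast rfl h := by
  cases h'
  exact ⟨rfl, by simp⟩

theorem IsTriv.trans_left {a b c : Y} {α : Homotopic.Quotient a b} {β : Homotopic.Quotient b c}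
    (h' : IsTriv α) : ∃ h : a = b, α.trans β = β.cast h rfl := by
  cases h'
  exact ⟨rfl, by simp⟩

/-- The class of the image of a path from `x` to `y`. -/
noncomputable def cls (p : C(E, Y)) (x y : E) : Path.Homotopic.Quotient (p x) (p y) :=
  (Homotopic.Quotient.mk (PathConnectedSpace.somePath x y)).map p

theorem cls_eq (p : C(E, Y)) (x y : E) (γ : Path.Homotopic.Quotient x y) :
    γ.map p = cls p x y := by
  unfold cls
  congr 1
  exact Subsingleton.elim _ _

theorem map_trans' {X : Type*} [TopologicalSpace X] (p : C(X, Y)) {x y z : X}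
    (α : Homotopic.Quotient x y) (β : Homotopic.Quotient y z) :
    (α.trans β).map p = (α.map p).trans (β.map p) := by
  induction α using Homotopic.Quotient.ind
  induction β using Homotopic.Quotient.ind
  rw [← Homotopic.Quotient.mk_trans, ← Homotopic.Quotient.mk_map, ← Homotopic.Quotient.mk_map, ← Homotopic.Quotient.mk_map,
    ← Homotopic.Quotient.mk_trans, Path.map_trans]

theorem map_symm' {X : Type*} [TopologicalSpace X] (p : C(X, Y)) {x y : X}
    (α : Homotopic.Quotient x y) :
    (α.symm).map p = (α.map p).symm := by
  induction α using Homotopic.Quotient.ind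
  rw [← Homotopic.Quotient.mk_symm, ← Homotopic.Quotient.mk_map, ← Homotopic.Quotient.mk_map, ← Homotopic.Quotient.mk_symm, Path.map_symm]

theorem cls_trans (p : C(E, Y)) (x y z : E) :
    (cls p x y).trans (cls p y z) = cls p x z := by
  rw [← cls_eq p x z (Homotopic.Quotient.trans (Homotopic.Quotient.mk (PathConnectedSpace.somePath x y))
    (Homotopic.Quotient.mk (PathConnectedSpace.somePath y z))), map_trans']
  rfl

theorem cls_symm (p : C(E, Y)) (x y : E) :
    (cls p x y).symm = cls p y x := by
  rw [← cls_eq p y x (Homotopic.Quotient.symm (Homotopic.Quotient.mk (PathConnectedSpace.somePath x y))), map_symm']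
  rfl

theorem cls_self (p : C(E, Y)) (x : E) : IsTriv (cls p x x) := by
  rw [← cls_eq p x x (Homotopic.Quotient.refl x), ← Homotopic.Quotient.mk_refl, ← Homotopic.Quotient.mk_map]
  exact IsTriv.refl _

theorem cls_comp_heq (p : C(E, Y)) (h : C(E, E)) (hp : p.comp h = p) (x y : E) :
    HEq (cls p (h x) (h y)) (cls p x y) := by
  let γ := PathConnectedSpace.somePath x y
  have h1 : cls p (h x) (h y) = Homotopic.Quotient.mk ((γ.map h.continuous).map p.continuous) := by
    rw [Homotopic.Quotient.mk_map, cls_eq]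
  have h2 : cls p x y = Homotopic.Quotient.mk (γ.map p.continuous) := by
    rw [Homotopic.Quotient.mk_map, cls_eq]
  rw [h1, h2]
  apply Path.Homotopic.hpath_hext
  intro t
  exact DFunLike.congr_fun hp (γ t)

theorem triv_of_fix_aux {a b b' : Y} (α : Homotopic.Quotient a b) (β : Homotopic.Quotient b' a) (hb : b' = b)
    (h : HEq β α.symm) : IsTriv (α.trans (β.cast hb.symm rfl)) := by
  subst hb
  cases h
  rw [Homotopic.Quotient.cast_rfl_rfl, Homotopic.Quotient.trans_symm]
  exact IsTriv.refl _

theorem isTriv_heq {a b a' b' : Y} {α : Homotopic.Quotient a b} {β : Homotopic.Quotient a' b'} (ha : a = a')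
    (hb : b = b') (h : HEq α β) (hα : IsTriv α) : IsTriv β := by
  subst ha hb
  cases h
  exact hα

theorem triv_of_fix (p : C(E, Y)) (h : C(E, E)) (hp : p.comp h = p) {y : E} (hy : h y = y) (x : E) :
    IsTriv (cls p x (h x)) := by
  have h1 := cls_comp_heq p h hp y x
  rw [hy] at h1
  have e : p (h x) = p x := DFunLike.congr_fun hp x
  rw [← cls_trans p x y (h x), ← cls_symm p y x]
  generalize cls p y (h x) = α at *
  generalize cls p y x = β at *
  revert α
  rw [e]
  intro α h1
  cases h1
  rw [Homotopic.Quotient.symm_trans]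
  exact IsTriv.refl _

/-- Standing data: the relation generated by affine symmetries with a fixed point. -/
def FixStep (p : E → Y) (x y : E) : Prop :=
  ∃ h : C(E, E), p ∘ h = p ∧ (∃ z, h z = z) ∧ h x = y

theorem triv_of_eqvGen (p : C(E, Y)) {x y : E} (h : Relation.EqvGen (FixStep p) x y) :
    IsTriv (cls p x y) := by
  induction h with
  | rel x y h =>
    obtain ⟨h, hp, ⟨z, hz⟩, rfl⟩ := h
    exact triv_of_fix p h (by ext t; exact congrFun hp t) hz x
  | refl x => exact cls_self p x
  | symm x y _ ih => rw [← cls_symm]; exact ih.symm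
  | trans x y z _ _ ih1 ih2 => rw [← cls_trans p x y z]; exact ih1.trans ih2

/-- All lifts represent the class. -/
def AllLifts (p : C(E, Y)) {a b : Y} (γ : Homotopic.Quotient a b) : Prop :=
  ∀ (x y : E) (hx : p x = a) (hy : p y = b), γ = (cls p x y).cast hx.symm hy.symm

theorem AllLifts.trans {p : C(E, Y)} (hs : Function.Surjective p) {a b c : Y} {α : Homotopic.Quotient a b}
    {β : Homotopic.Quotient b c} (hα : AllLifts p α) (hβ : AllLifts p β) : AllLifts p (α.trans β) := by
  rintro x z rfl rfl
  obtain ⟨y, rfl⟩ := hs b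
  rw [hα x y rfl rfl, hβ y z rfl rfl]
  simp [cls_trans]

theorem allLifts_cls {p : C(E, Y)} (hT : ∀ x y, p x = p y → IsTriv (cls p x y)) (x y : E) :
    AllLifts p (cls p x y) := by
  intro x' y' hx hy
  obtain ⟨e1, h1⟩ := (hT x x' hx.symm).trans_left (β := cls p x' y')
  obtain ⟨e2, h2⟩ := (hT y' y hy).trans_right (α := cls p x y')
  rw [cls_trans] at h1 h2
  rw [h2, h1]
  simp

/-- A neighbourhood modelled on a cone. -/
def ConeNhd (p : E → Y) (x : E) (B : Set E) : Prop :=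
  IsOpen B ∧ Convex ℝ B ∧ x ∈ B ∧ ∀ b ∈ B, ∀ b' ∈ B, p b = p b' →
    ∃ h : E →ᴬ[ℝ] E, p ∘ h = p ∧ h x = x ∧ h b = b'

theorem contractible_of_cone {p : E → Y} (ho : IsOpenMap p) (hc : Continuous p) {x : E} {B : Set E}
    (hB : ConeNhd p x B) : ContractibleSpace (p '' B) := by
  obtain ⟨hBo, hBc, hxB, hB⟩ := hB
  let q : B → p '' B := fun b => ⟨p b, b, b.2, rfl⟩
  have hq : IsOpenQuotientMap q := by
    refine ⟨?_, ?_, ?_⟩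
    · rintro ⟨_, b, hb, rfl⟩; exact ⟨⟨b, hb⟩, rfl⟩
    · fun_prop
    · exact (ho.comp hBo.isOpenMap_subtype_val).subtype_mk _
  have hQ : IsOpenQuotientMap (Prod.map (id : I → I) q) := IsOpenQuotientMap.id.prodMap hq
  have hseg : ∀ (s : I) (b : B), AffineMap.lineMap (b : E) x (s : ℝ) ∈ B := fun s b =>
    hBc.lineMap_mem b.2 hxB s.2
  let φ : I × B → p '' B := fun sb => q ⟨AffineMap.lineMap (sb.2 : E) x (sb.1 : ℝ), hseg _ _⟩
  have hφ : Continuous φ := by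
    apply hq.continuous.comp
    apply Continuous.subtype_mk
    simp only [AffineMap.lineMap_apply_module]
    fun_prop
  have hfac : ∀ u v, Prod.map (id : I → I) q u = Prod.map id q v → φ u = φ v := by
    rintro ⟨s, b⟩ ⟨s', b'⟩ huv
    obtain ⟨rfl, h2⟩ := Prod.ext_iff.1 huv
    obtain ⟨h, hp, hx, hb⟩ := hB b b.2 b' b'.2 (congrArg Subtype.val h2)
    apply Subtype.ext
    change p _ = p _
    change p _ = p (AffineMap.lineMap (b' : E) x (s : ℝ))
    rw [← hb]
    nth_rewrite 2 [← hx]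
    have := (h : E →ᵃ[ℝ] E).apply_lineMap (b : E) x (s : ℝ)
    simp only [ContinuousAffineMap.coe_toAffineMap] at this
    rw [← this]
    exact (congrFun hp _).symm
  rw [contractible_iff_id_nullhomotopic]
  let Φ : I × (p '' B) → p '' B := fun u => φ (Function.surjInv hQ.surjective u)
  have hΦ : ∀ u, Φ (Prod.map id q u) = φ u := fun u =>
    hfac _ _ (Function.surjInv_eq hQ.surjective _)
  have hΦc : Continuous Φ := by
    rw [← hQ.continuous_comp_iff]
    convert hφ using 1
    ext1 u
    exact hΦ u
  refine ⟨q ⟨x, hxB⟩, ⟨⟨⟨Φ, hΦc⟩, ?_, ?_⟩⟩⟩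
  · intro y
    obtain ⟨b, rfl⟩ := hq.surjective y
    have := hΦ (0, b)
    simpa [φ] using this
  · intro y
    obtain ⟨b, rfl⟩ := hq.surjective y
    have := hΦ (1, b)
    simpa [φ] using this

theorem allLifts_local {p : C(E, Y)} (ho : IsOpenMap p)
    (hT : ∀ x y, p x = p y → IsTriv (cls p x y)) {x : E} {B : Set E} (hB : ConeNhd p x B)
    {a b : Y} (γ : Path a b) (hγ : ∀ t, γ t ∈ p '' B) : AllLifts p (Homotopic.Quotient.mk γ) := by
  have := contractible_of_cone ho p.continuous hB
  obtain ⟨u, hu, hua⟩ : a ∈ p '' B := by simpa using hγ 0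
  obtain ⟨v, hv, hvb⟩ : b ∈ p '' B := by simpa using hγ 1
  subst hua hvb
  have key : Homotopic.Quotient.mk γ = cls p u v := by
    let γ' : Path (⟨p u, u, hu, rfl⟩ : p '' B) ⟨p v, v, hv, rfl⟩ :=
      ⟨⟨fun t => ⟨γ t, hγ t⟩, by fun_prop⟩, by simp, by simp⟩
    have hseg : ∀ s : I, AffineMap.lineMap u v (s : ℝ) ∈ B := fun s =>
      hB.2.1.lineMap_mem hu hv s.2
    let δ : Path u v := ⟨⟨fun s => AffineMap.lineMap u v (s : ℝ), by
      simp only [AffineMap.lineMap_apply_module]; fun_prop⟩, by simp, by simp⟩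
    let δ' : Path (⟨p u, u, hu, rfl⟩ : p '' B) ⟨p v, v, hv, rfl⟩ :=
      ⟨⟨fun t => ⟨p (δ t), _, hseg t, rfl⟩, by fun_prop⟩, by simp, by simp⟩
    have h1 := (SimplyConnectedSpace.paths_homotopic γ' δ').map ⟨Subtype.val, continuous_subtype_val⟩
    rw [← cls_eq p u v (Homotopic.Quotient.mk δ), ← Homotopic.Quotient.mk_map]
    exact Homotopic.Quotient.eq.2 h1
  rw [key]
  exact allLifts_cls hT u v

theorem simplyConnected_general {p : E → Y} (hp : IsOpenQuotientMap p)
    (hgen : ∀ x y, p x = p y → Relation.EqvGen (FixStep p) x y)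
    (hcone : ∀ x, ∃ B, ConeNhd p x B) : SimplyConnectedSpace Y := by
  lift p to C(E, Y) using hp.continuous
  have hT : ∀ x y, p x = p y → IsTriv (cls p x y) := fun x y h => triv_of_eqvGen p (hgen x y h)
  have : PathConnectedSpace Y := hp.surjective.pathConnectedSpace hp.continuous
  choose B hB using hcone
  rw [simply_connected_iff_paths_homotopic']
  refine ⟨this, ?_⟩
  suffices H : ∀ {a b : Y} (γ : Path a b), AllLifts p (Homotopic.Quotient.mk γ) by
    intro a b γ δ
    obtain ⟨x, hx⟩ := hp.surjective a
    obtain ⟨y, hy⟩ := hp.surjective b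
    exact Homotopic.Quotient.eq.1 ((H γ x y hx hy).trans (H δ x y hx hy).symm)
  intro a b γ
  obtain ⟨t, ht0, htm, ⟨n, hn⟩, ht⟩ := exists_monotone_Icc_subset_open_cover_unitInterval
    (c := fun x : E => γ ⁻¹' (p '' B x))
    (fun x => (hp.isOpenMap _ (hB x).1).preimage γ.continuous)
    (fun s _ => by
      obtain ⟨x, hx⟩ := hp.surjective (γ s)
      exact Set.mem_iUnion.2 ⟨x, x, (hB x).2.2.1, hx⟩)
  have main : ∀ m, AllLifts p (Homotopic.Quotient.mk (γ.subpath (t 0) (t m))) := by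
    intro m
    induction m with
    | zero =>
      rw [Path.subpath_self]
      obtain ⟨x, hx⟩ := hp.surjective (γ (t 0))
      exact allLifts_local hp.isOpenMap hT (hB x) _ (fun s => ⟨x, (hB x).2.2.1, by simpa using hx⟩)
    | succ m ih =>
      have h2 : AllLifts p (Homotopic.Quotient.mk (γ.subpath (t m) (t (m+1)))) := by
        obtain ⟨x, hx⟩ := ht m
        refine allLifts_local hp.isOpenMap hT (hB x) _ (fun s => ?_)
        have : γ.subpath (t m) (t (m+1)) s ∈ Set.range (γ.subpath (t m) (t (m+1))) := ⟨s, rfl⟩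
        rw [Path.range_subpath_of_le _ _ _ (htm (Nat.le_succ m))] at this
        obtain ⟨r, hr, hr'⟩ := this
        rw [← hr']
        exact hx hr
      have := ih.trans hp.surjective h2
      rw [← Homotopic.Quotient.mk_trans] at this
      rwa [Homotopic.Quotient.eq.2 ⟨Path.Homotopy.subpathTransSubpath γ (t 0) (t m) (t (m+1))⟩] at this
  have hfin := main n
  rw [ht0, hn n le_rfl, Path.subpath_zero_one] at hfin
  intro x y hx hy
  have := hfin x y (by simpa using hx) (by simpa using hy)
  subst hx hy
  rw [Homotopic.Quotient.mk_cast] at this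
  have h3 := congrArg (fun q => Homotopic.Quotient.cast q γ.source.symm γ.target.symm) this
  simpa using h3

end General
end X131

namespace X131

/-! ### The lattice and the linear maps -/

theorem ω_sq : ω₀ * ω₀ = -1 - ω₀ := by
  have h3 : IsPrimitiveRoot ω₀ 3 := by
    have := Complex.isPrimitiveRoot_exp 3 (by norm_num)
    simpa [ω₀] using this
  have h := h3.geom_sum_eq_zero (by norm_num)
  simp [Finset.sum_range_succ] at h
  linear_combination h

theorem ω_conj : (starRingEnd ℂ) ω₀ = -1 - ω₀ := by
  rw [← ω_sq, ω₀, ← Complex.exp_conj, ← Complex.exp_add]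
  rw [Complex.exp_eq_exp_iff_exists_int]
  refine ⟨-1, ?_⟩
  have h2 : (starRingEnd ℂ) 2 = 2 := Complex.conj_ofNat 2
  have h3 : (starRingEnd ℂ) 3 = 3 := Complex.conj_ofNat 3
  simp [h2, h3]
  ring

theorem ω_re : ω₀.re = -1/2 := by
  have h := congrArg Complex.re ω_conj
  simp at h
  linarith

theorem ω_im_sq : ω₀.im * ω₀.im = 3/4 := by
  have h := congrArg Complex.re ω_sq
  simp [ω_re] at h
  linarith

abbrev V : Type := ℂ × ℂ × ℂ

/-- The linear lift of `F`. -/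
noncomputable def Fl : V ≃ₗ[ℝ] V where
  toFun z := (ω₀ * z.1, ω₀ * z.2.1 - ω₀ * z.1, ω₀ * z.2.2)
  map_add' x y := by ext1; simp [mul_add]; ext1 <;> simp <;> ring
  map_smul' r x := by
    ext1
    · simp; ring
    · ext1 <;> simp <;> ring
  invFun z := ((-1 - ω₀) * z.1, (-1 - ω₀) * (z.2.1 + z.1), (-1 - ω₀) * z.2.2)
  left_inv z := by
    obtain ⟨a, b, c⟩ := z
    simp only [Prod.mk.injEq]
    refine ⟨?_, ?_, ?_⟩
    · linear_combination (-a) * ω_sq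
    · linear_combination (-b) * ω_sq
    · linear_combination (-c) * ω_sq
  right_inv z := by
    obtain ⟨a, b, c⟩ := z
    simp only [Prod.mk.injEq]
    refine ⟨?_, ?_, ?_⟩
    · linear_combination (-a) * ω_sq
    · linear_combination (-b) * ω_sq
    · linear_combination (-c) * ω_sq

/-- The linear lift of `η`. -/
noncomputable def ηl : V ≃ₗ[ℝ] V where
  toFun z := (-(starRingEnd ℂ z.1), starRingEnd ℂ z.2.1 + starRingEnd ℂ z.1, -(starRingEnd ℂ z.2.2))
  map_add' x y := by
    simp only [Prod.fst_add, Prod.snd_add, map_add, Prod.mk_add_mk, Prod.mk.injEq]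
    refine ⟨?_, ?_, ?_⟩ <;> ring
  map_smul' r x := by
    simp [Complex.real_smul, mul_add]
  invFun z := (-(starRingEnd ℂ z.1), starRingEnd ℂ z.2.1 + starRingEnd ℂ z.1, -(starRingEnd ℂ z.2.2))
  left_inv z := by simp
  right_inv z := by simp

theorem Fl_apply (a b c : ℂ) : Fl (a, b, c) = (ω₀ * a, ω₀ * b - ω₀ * a, ω₀ * c) := rfl
theorem Fl_inv_apply (a b c : ℂ) :
    Fl⁻¹ (a, b, c) = ((-1 - ω₀) * a, (-1 - ω₀) * (b + a), (-1 - ω₀) * c) := rfl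
theorem ηl_apply (a b c : ℂ) : ηl (a, b, c) =
  (-(starRingEnd ℂ a), starRingEnd ℂ b + starRingEnd ℂ a, -(starRingEnd ℂ c)) := rfl

theorem ηl_mul_self : ηl * ηl = 1 := by
  ext1 z
  exact ηl.left_inv z

theorem ηl_inv : ηl⁻¹ = ηl := inv_eq_of_mul_eq_one_left ηl_mul_self

theorem ηl_Fl : ηl * Fl * ηl⁻¹ = Fl⁻¹ := by
  rw [ηl_inv]
  ext1 z
  obtain ⟨a, b, c⟩ := z
  change ηl (Fl (ηl (a, b, c))) = _
  rw [ηl_apply, Fl_apply, ηl_apply, Fl_inv_apply]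
  simp [ω_conj]

theorem ηl_zpow (n : ℤ) : ηl * Fl ^ n = Fl ^ (-n) * ηl := by
  have h := conj_zpow (i := n) (a := ηl) (b := Fl)
  rw [ηl_Fl, inv_zpow] at h
  rw [zpow_neg, h]
  group

/-- The lattice `Γ₁³`, sliced by the value of the character to `ℤ/3`. -/
def Λ (j : ZMod 3) : Set V := {γ | ∃ a₁ b₁ a₂ b₂ a₃ b₃ : ℤ,
  γ = ((a₁ : ℂ) + b₁ * ω₀, (a₂ : ℂ) + b₂ * ω₀, (a₃ : ℂ) + b₃ * ω₀) ∧
    ((a₂ + b₂ - a₁ : ℤ) : ZMod 3) = j}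

theorem Λ_add {i j : ZMod 3} {x y : V} (hx : x ∈ Λ i) (hy : y ∈ Λ j) : x + y ∈ Λ (i + j) := by
  obtain ⟨a₁, b₁, a₂, b₂, a₃, b₃, rfl, rfl⟩ := hx
  obtain ⟨c₁, d₁, c₂, d₂, c₃, d₃, rfl, rfl⟩ := hy
  refine ⟨a₁ + c₁, b₁ + d₁, a₂ + c₂, b₂ + d₂, a₃ + c₃, b₃ + d₃, ?_, ?_⟩
  · simp only [Prod.mk_add_mk, Prod.mk.injEq]
    push_cast
    refine ⟨?_, ?_, ?_⟩ <;> ring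
  · push_cast; ring

theorem Λ_neg {i : ZMod 3} {x : V} (hx : x ∈ Λ i) : -x ∈ Λ (-i) := by
  obtain ⟨a₁, b₁, a₂, b₂, a₃, b₃, rfl, rfl⟩ := hx
  refine ⟨-a₁, -b₁, -a₂, -b₂, -a₃, -b₃, ?_, ?_⟩
  · simp only [Prod.neg_mk, Prod.mk.injEq]
    push_cast
    refine ⟨?_, ?_, ?_⟩ <;> ring
  · push_cast; ring

theorem Λ_zero : (0 : V) ∈ Λ 0 := ⟨0, 0, 0, 0, 0, 0, by simp; rfl, by simp⟩

theorem Λ_Fl {i : ZMod 3} {x : V} (hx : x ∈ Λ i) : Fl x ∈ Λ i := by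
  obtain ⟨a₁, b₁, a₂, b₂, a₃, b₃, rfl, rfl⟩ := hx
  refine ⟨-b₁, a₁ - b₁, -b₂ + b₁, a₂ - b₂ - a₁ + b₁, -b₃, a₃ - b₃, ?_, ?_⟩
  · rw [Fl_apply]
    simp only [Prod.mk.injEq]
    push_cast
    refine ⟨?_, ?_, ?_⟩
    · linear_combination b₁ * ω_sq
    · linear_combination (b₂ - b₁) * ω_sq
    · linear_combination b₃ * ω_sq
  · have h3 : (3 : ZMod 3) = 0 := rfl
    push_cast
    linear_combination (b₁ - b₂) * h3

theorem Λ_Fl_inv {i : ZMod 3} {x : V} (hx : x ∈ Λ i) : Fl⁻¹ x ∈ Λ i := by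
  obtain ⟨a₁, b₁, a₂, b₂, a₃, b₃, rfl, rfl⟩ := hx
  refine ⟨-a₁ + b₁, -a₁, -(a₂ + a₁) + (b₂ + b₁), -(a₂ + a₁), -a₃ + b₃, -a₃, ?_, ?_⟩
  · rw [Fl_inv_apply]
    simp only [Prod.mk.injEq]
    push_cast
    refine ⟨?_, ?_, ?_⟩
    · linear_combination (-b₁) * ω_sq
    · linear_combination (-b₂ - b₁) * ω_sq
    · linear_combination (-b₃) * ω_sq
  · have h3 : (3 : ZMod 3) = 0 := rfl
    push_cast
    linear_combination (- a₂) * h3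

theorem Λ_ηl {i : ZMod 3} {x : V} (hx : x ∈ Λ i) : ηl x ∈ Λ i := by
  obtain ⟨a₁, b₁, a₂, b₂, a₃, b₃, rfl, rfl⟩ := hx
  refine ⟨-a₁ + b₁, b₁, a₂ - b₂ + (a₁ - b₁), - b₂ - b₁, -a₃ + b₃, b₃, ?_, ?_⟩
  · rw [ηl_apply]
    simp only [Prod.mk.injEq, map_add, map_mul, ω_conj, map_intCast]
    push_cast
    refine ⟨?_, ?_, ?_⟩ <;> ring
  · have h3 : (3 : ZMod 3) = 0 := rfl
    push_cast
    linear_combination (a₁ - b₂ - b₁) * h3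

/-- Linear maps preserving all slices. -/
def St : Subgroup (V ≃ₗ[ℝ] V) where
  carrier := {A | ∀ j x, A x ∈ Λ j ↔ x ∈ Λ j}
  mul_mem' {A B} hA hB j x := (hA j (B x)).trans (hB j x)
  one_mem' j x := Iff.rfl
  inv_mem' {A} hA j x := by
    rw [← hA j (A⁻¹ x)]
    change (A * A⁻¹) x ∈ _ ↔ _
    rw [mul_inv_cancel]; rfl

theorem Fl_mem : Fl ∈ St := fun _ x => ⟨fun h => by
  have := Λ_Fl_inv h
  change (Fl⁻¹ * Fl) x ∈ _ at this
  rwa [inv_mul_cancel] at this, Λ_Fl⟩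

theorem ηl_mem : ηl ∈ St := fun _ x => ⟨fun h => by
  have := Λ_ηl h
  change (ηl * ηl) x ∈ _ at this
  rwa [ηl_mul_self] at this, Λ_ηl⟩

/-- Linear parts of group elements. -/
noncomputable def lin (b : Bool) (n : ℤ) : V ≃ₗ[ℝ] V := bif b then Fl ^ n * ηl else Fl ^ n

/-- The action on the real line. -/
def tp (b : Bool) (n : ℤ) (t : ℝ) : ℝ := bif b then n + 1 - t else t + n

theorem lin_mem (b : Bool) (n : ℤ) : lin b n ∈ St := by
  cases b
  · exact zpow_mem Fl_mem n
  · exact mul_mem (zpow_mem Fl_mem n) ηl_mem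

theorem lin_Λ (b : Bool) (n : ℤ) {j : ZMod 3} {x : V} (hx : x ∈ Λ j) : lin b n x ∈ Λ j :=
  (lin_mem b n j x).2 hx

theorem lin_lin (b b' : Bool) (n n' : ℤ) (z : V) :
    lin b n (lin b' n' z) = lin (xor b b') (n + bif b then -n' else n') z := by
  change (lin b n * lin b' n') z = _
  congr 1
  cases b <;> cases b' <;> simp only [lin, cond_true, cond_false, Bool.xor_true, Bool.xor_false,
    Bool.not_true, Bool.not_false, zpow_add]
  · group
  · rw [mul_assoc, ηl_zpow, mul_assoc]
  · rw [← mul_assoc, mul_assoc (Fl ^ n), ηl_zpow, mul_assoc, mul_assoc, ηl_mul_self, mul_one]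

theorem tp_tp (b b' : Bool) (n n' : ℤ) (t : ℝ) :
    tp b n (tp b' n' t) = tp (xor b b') (n + bif b then -n' else n') t := by
  cases b <;> cases b' <;> simp [tp] <;> ring

theorem lin_false_zero (z : V) : lin false 0 z = z := by simp [lin]

theorem tp_false_zero (t : ℝ) : tp false 0 t = t := by simp [tp]

/-- The orbit relation, sliced by the character. -/
def R (j : ZMod 3) (x y : ℝ × V) : Prop :=
  ∃ (b : Bool) (n : ℤ), ∃ γ ∈ Λ j, y = (tp b n x.1, lin b n x.2 + γ)

theorem R_refl (x : ℝ × V) : R 0 x x :=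
  ⟨false, 0, 0, Λ_zero, by rw [lin_false_zero, tp_false_zero, add_zero]⟩

theorem R_trans {i j : ZMod 3} {x y z : ℝ × V} (h : R i x y) (h' : R j y z) : R (i + j) x z := by
  obtain ⟨b, n, γ, hγ, rfl⟩ := h
  obtain ⟨b', n', γ', hγ', rfl⟩ := h'
  refine ⟨xor b' b, n' + bif b' then -n else n, lin b' n' γ + γ', Λ_add (lin_Λ _ _ hγ) hγ', ?_⟩
  simp only [map_add, lin_lin, tp_tp, add_assoc]

theorem R_symm {i : ZMod 3} {x y : ℝ × V} (h : R i x y) : R (-i) y x := by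
  obtain ⟨b, n, γ, hγ, rfl⟩ := h
  refine ⟨b, bif b then n else -n, -(lin b (bif b then n else -n) γ), Λ_neg (lin_Λ _ _ hγ), ?_⟩
  simp only [map_add, lin_lin, tp_tp]
  cases b <;> simp [lin_false_zero, tp_false_zero]

/-! ### Discreteness -/

theorem eis_zero {a b : ℤ} (h : ‖(a : ℂ) + b * ω₀‖ < 1/2) : a = 0 ∧ b = 0 := by
  have h1 : ‖(a : ℂ) + b * ω₀‖ ^ 2 < (1/2)^2 := by gcongr
  rw [← Complex.normSq_eq_norm_sq, Complex.normSq_apply] at h1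
  simp [ω_re] at h1
  have h2 := ω_im_sq
  have h3 : (a : ℝ)^2 - a * b + b^2 < 1 := by
    have : (b : ℝ) * ω₀.im * (b * ω₀.im) = b^2 * (3/4) := by rw [← h2]; ring
    rw [this] at h1
    nlinarith
  have h4 : a^2 - a * b + b^2 < 1 := by exact_mod_cast h3
  have ha : a^2 < 2 := by nlinarith [sq_nonneg (a - 2*b)]
  have hb : b^2 < 2 := by nlinarith [sq_nonneg (b - 2*a)]
  have ha1 : a < 2 := by nlinarith
  have ha2 : -2 < a := by nlinarith
  have hb1 : b < 2 := by nlinarith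
  have hb2 : -2 < b := by nlinarith
  interval_cases a <;> interval_cases b <;> simp_all

theorem Λ_small {j : ZMod 3} {γ : V} (h : γ ∈ Λ j) (hγ : ‖γ‖ < 1/2) : γ = 0 ∧ j = 0 := by
  obtain ⟨a₁, b₁, a₂, b₂, a₃, b₃, rfl, rfl⟩ := h
  simp only [Prod.norm_def, sup_lt_iff] at hγ
  obtain ⟨h1, h2, h3⟩ := hγ
  obtain ⟨rfl, rfl⟩ := eis_zero h1
  obtain ⟨rfl, rfl⟩ := eis_zero h2
  obtain ⟨rfl, rfl⟩ := eis_zero h3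
  simp

theorem Λ_unique {i j : ZMod 3} {γ : V} (h : γ ∈ Λ i) (h' : γ ∈ Λ j) : i = j := by
  have := Λ_add h (Λ_neg h')
  rw [add_neg_cancel] at this
  have := (Λ_small this (by simp)).2
  linear_combination this

theorem Λ_eps (w : V) : ∃ ε > 0, ∀ j, ∀ γ ∈ Λ j, ‖γ - w‖ < ε → γ = w := by
  by_cases h : ∃ j, ∃ γ ∈ Λ j, γ ≠ w ∧ ‖γ - w‖ < 1/4
  · obtain ⟨j, γ, hγ, hne, hlt⟩ := h
    refine ⟨‖γ - w‖, norm_pos_iff.2 (sub_ne_zero.2 hne), fun i γ' hγ' h' => ?_⟩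
    exfalso
    have h2 : ‖γ' + -γ‖ < 1/2 := by
      have : γ' + -γ = (γ' - w) - (γ - w) := by abel
      rw [this]
      refine (norm_sub_le _ _).trans_lt ?_
      linarith
    have := (Λ_small (Λ_add hγ' (Λ_neg hγ)) h2).1
    have : γ' = γ := by rw [← sub_eq_add_neg] at this; exact sub_eq_zero.1 this
    subst this
    exact lt_irrefl _ h'
  · push Not at h
    refine ⟨1/4, by norm_num, fun j γ hγ h' => ?_⟩
    by_contra hne
    exact absurd h' (not_lt.2 (h j γ hγ hne))

theorem int_eps (s : ℝ) : ∃ ε > 0, ∀ n : ℤ, |(n : ℝ) - s| < ε → (n : ℝ) = s := by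
  by_cases h : ∃ n : ℤ, (n : ℝ) ≠ s ∧ |(n : ℝ) - s| < 1/4
  · obtain ⟨n, hne, hlt⟩ := h
    refine ⟨|(n : ℝ) - s|, abs_pos.2 (sub_ne_zero.2 hne), fun m h' => ?_⟩
    exfalso
    have h2 : |((m - n : ℤ) : ℝ)| < 1 := by
      have h4 := abs_lt.1 (h'.trans hlt)
      have h5 := abs_lt.1 hlt
      rw [abs_lt]
      push_cast
      constructor <;> linarith
    have h3 : |m - n| < 1 := by exact_mod_cast h2
    have : m = n := by
      have := Int.abs_lt_one_iff.1 h3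
      omega
    subst this
    exact lt_irrefl _ h'
  · push Not at h
    refine ⟨1/4, by norm_num, fun n h' => ?_⟩
    by_contra hne
    exact absurd h' (not_lt.2 (h n hne))

/-- The group elements as continuous affine maps. -/
noncomputable def aff (b : Bool) (n : ℤ) (γ : V) : (ℝ × V) →ᴬ[ℝ] (ℝ × V) :=
  ((((bif b then (-1 : ℝ) else 1) • ContinuousLinearMap.fst ℝ ℝ V).prod
    ((LinearMap.toContinuousLinearMap (lin b n : V →ₗ[ℝ] V)).comp
      (ContinuousLinearMap.snd ℝ ℝ V))).toContinuousAffineMap) +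
  ContinuousAffineMap.const ℝ (ℝ × V) ((bif b then (n : ℝ) + 1 else n), γ)

theorem aff_apply (b : Bool) (n : ℤ) (γ : V) (x : ℝ × V) :
    aff b n γ x = (tp b n x.1, lin b n x.2 + γ) := by
  cases b <;> simp [aff, tp]
  ring

theorem R_aff (b : Bool) (n : ℤ) {j : ZMod 3} {γ : V} (hγ : γ ∈ Λ j) (x : ℝ × V) :
    R j x (aff b n γ x) := ⟨b, n, γ, hγ, aff_apply _ _ _ _⟩

theorem exists_cone (x : ℝ × V) : ∃ δ > 0, ∀ j, ∀ y ∈ Metric.ball x δ, ∀ y' ∈ Metric.ball x δ,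
    R j y y' → j = 0 ∧ ∃ h : (ℝ × V) →ᴬ[ℝ] (ℝ × V), (∀ u, R 0 u (h u)) ∧ h x = x ∧ h y = y' := by
  obtain ⟨t₀, z₀⟩ := x
  obtain ⟨ε₁, hε₁, H₁⟩ := int_eps (2 * t₀ - 1)
  obtain ⟨ε₂, hε₂, H₂⟩ := Λ_eps (z₀ - lin true ⌊2 * t₀ - 1⌋ z₀)
  have hcont : Continuous fun u : V × V => u.2 - lin true ⌊2 * t₀ - 1⌋ u.1 := by
    have : Continuous (lin true ⌊2 * t₀ - 1⌋) :=
      LinearMap.continuous_of_finiteDimensional ((lin true ⌊2 * t₀ - 1⌋ : V ≃ₗ[ℝ] V) : V →ₗ[ℝ] V)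
    fun_prop
  obtain ⟨δ₃, hδ₃, H₃⟩ := Metric.continuous_iff.1 hcont (z₀, z₀) ε₂ hε₂
  refine ⟨min (1/4) (min (ε₁ / 2) δ₃), by positivity, ?_⟩
  rintro j ⟨t, z⟩ hy ⟨t', z'⟩ hy' ⟨b, n, γ, hγ, hR⟩
  rw [Metric.mem_ball, Prod.dist_eq, max_lt_iff, lt_min_iff, lt_min_iff, lt_min_iff, lt_min_iff]
    at hy hy'
  obtain ⟨⟨ht1, ht2, ht3⟩, hz1, hz2, hz3⟩ := hy
  obtain ⟨⟨ht1', ht2', ht3'⟩, hz1', hz2', hz3'⟩ := hy'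
  obtain ⟨hRt, hRz⟩ := Prod.ext_iff.1 hR
  simp only at hRt hRz
  rw [Real.dist_eq, abs_lt] at ht1 ht2 ht1' ht2'
  cases b
  · simp only [tp, cond_false] at hRt
    have hn : n = 0 := by
      have : |n| < 1 := by
        have : |(n : ℝ)| < 1 := by rw [abs_lt]; constructor <;> linarith
        exact_mod_cast this
      exact Int.abs_lt_one_iff.1 this
    subst hn
    rw [lin_false_zero] at hRz
    have hs : ‖γ‖ < 1/2 := by
      have : γ = (z' - z₀) - (z - z₀) := by rw [hRz]; abel
      rw [this]
      refine (norm_sub_le _ _).trans_lt ?_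
      rw [← dist_eq_norm, ← dist_eq_norm]
      have h1 : dist z z₀ < 1/4 := hz1
      have h2 : dist z' z₀ < 1/4 := hz1'
      linarith
    obtain ⟨rfl, rfl⟩ := Λ_small hγ hs
    refine ⟨rfl, ContinuousAffineMap.id ℝ _, fun u => R_refl u, rfl, ?_⟩
    rw [hR]
    change (t, z) = _
    simp [lin_false_zero, tp_false_zero]
  · simp only [tp, cond_true] at hRt
    have hn : (n : ℝ) = 2 * t₀ - 1 := H₁ n (by rw [abs_lt]; constructor <;> linarith)
    have hfl : ⌊2 * t₀ - 1⌋ = n := by rw [← hn, Int.floor_intCast]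
    rw [hfl] at H₂ H₃
    have hw : γ = z₀ - lin true n z₀ := by
      apply H₂ j γ hγ
      have := H₃ (z, z') (by
        rw [Prod.dist_eq]; exact max_lt hz3 hz3')
      rw [dist_eq_norm] at this
      simp only at this
      rwa [hRz, add_sub_cancel_left] at this
    have hneg : lin true n γ = -γ := by
      rw [hw, map_sub, lin_lin]
      simp [lin_false_zero]
    have hj : j = 0 := by
      have h1 := lin_Λ true n hγ
      rw [hneg] at h1
      have h2 : ∀ i : ZMod 3, i = -i → i = 0 := by decide
      exact h2 j (Λ_unique h1 (Λ_neg hγ))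
    subst hj
    refine ⟨rfl, aff true n γ, fun u => R_aff _ _ hγ u, ?_, ?_⟩
    · rw [aff_apply]
      simp only [tp, cond_true, hn, hw]
      ext1
      · simp; ring
      · simp
    · rw [aff_apply, hR]

/-! ### The simply connected cover -/

/-- The setoid of `R 0`. -/
def RS : Setoid (ℝ × V) where
  r := R 0
  iseqv := ⟨R_refl, fun h => by simpa using R_symm h, fun h h' => by simpa using R_trans h h'⟩

/-- The universal cover of `X`. -/
abbrev Yc : Type := Quotient RS

/-- The projection. -/
def pY : ℝ × V → Yc := Quotient.mk RS

theorem pY_eq {x y : ℝ × V} : pY x = pY y ↔ R 0 x y := Quotient.eq (r := RS)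

theorem continuous_aff (b : Bool) (n : ℤ) (γ : V) : Continuous (aff b n γ) :=
  (aff b n γ).cont

theorem pY_open : IsOpenQuotientMap pY := by
  refine ⟨Quotient.mk_surjective, continuous_quotient_mk', fun U hU => ?_⟩
  change IsOpen (pY ⁻¹' (pY '' U))
  have : pY ⁻¹' (pY '' U) = ⋃ (b : Bool) (n : ℤ) (γ ∈ Λ 0), aff b n γ ⁻¹' U := by
    ext x
    simp only [Set.mem_preimage, Set.mem_image, Set.mem_iUnion, exists_prop]
    constructor
    · rintro ⟨y, hy, hyx⟩
      obtain ⟨b, n, γ, hγ, rfl⟩ := pY_eq.1 hyx.symm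
      exact ⟨b, n, γ, hγ, by rwa [aff_apply]⟩
    · rintro ⟨b, n, γ, hγ, h⟩
      exact ⟨_, h, (pY_eq.2 (R_aff b n hγ x)).symm⟩
  rw [this]
  exact isOpen_iUnion fun b => isOpen_iUnion fun n => isOpen_iUnion fun γ => isOpen_iUnion fun _ =>
    hU.preimage (continuous_aff b n γ)

end X131

namespace X131

/-! ### Generation by elements with fixed points -/

theorem step_true {n : ℤ} {γ : V} (hγ : γ ∈ Λ 0) (h : lin true n γ = -γ) (x : ℝ × V) :
    FixStep pY x (aff true n γ x) := by
  refine ⟨⟨aff true n γ, continuous_aff _ _ _⟩, ?_, ?_, rfl⟩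
  · funext u
    exact (pY_eq.2 (R_aff _ _ hγ u)).symm
  · refine ⟨(((n : ℝ) + 1) / 2, (2⁻¹ : ℝ) • γ), ?_⟩
    change aff true n γ _ = _
    rw [aff_apply]
    simp only [map_smul, h, tp, cond_true]
    ext1
    · simp; ring
    · simp only
      have : γ = (2⁻¹ : ℝ) • γ + (2⁻¹ : ℝ) • γ := by
        rw [← add_smul]; norm_num
      nth_rw 2 [this]
      rw [smul_neg]; abel

/-- The generated equivalence. -/
abbrev C (x y : ℝ × V) : Prop := Relation.EqvGen (FixStep pY) x y

theorem C_true_zero (n : ℤ) (x : ℝ × V) : C x (aff true n 0 x) :=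
  .rel _ _ (step_true Λ_zero (by simp) x)

theorem C_false_zero (n : ℤ) (x : ℝ × V) : C x (aff false n 0 x) := by
  have h := (C_true_zero 0 x).trans _ _ _ (C_true_zero n (aff true 0 0 x))
  convert h using 1
  simp only [aff_apply, add_zero, lin_lin, tp_tp]
  simp

theorem C_lin_zero (b : Bool) (n : ℤ) (x : ℝ × V) : C x (aff b n 0 x) := by
  cases b
  · exact C_false_zero n x
  · exact C_true_zero n x

/-- Translations reached. -/
def G : AddSubgroup V where
  carrier := {γ | ∀ x : ℝ × V, C x (x.1, x.2 + γ)}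
  zero_mem' x := by rw [add_zero]; exact .refl _
  add_mem' {a b} ha hb x := by
    have := (ha x).trans _ _ _ (hb _)
    simpa [add_assoc] using this
  neg_mem' {a} ha x := by
    have := (ha (x.1, x.2 + -a)).symm
    simpa using this

theorem G_step {γ : V} (hγ : γ ∈ Λ 0) (h : ηl γ = -γ) : γ ∈ G := by
  intro x
  have h' : lin true 0 γ = -γ := by simpa [lin] using h
  have := (C_true_zero 0 x).trans _ _ _ (.rel _ _ (step_true hγ h' (aff true 0 0 x)))
  convert this using 1
  simp only [aff_apply, add_zero, lin_lin, tp_tp]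
  simp [lin_false_zero, tp_false_zero]

theorem G_Fl {γ : V} (hγ : γ ∈ G) : Fl γ ∈ G := by
  intro x
  have h1 := C_false_zero (-1) x
  have h2 := hγ (aff false (-1) 0 x)
  have h3 := C_false_zero 1 ((aff false (-1) 0 x).1, (aff false (-1) 0 x).2 + γ)
  have := (h1.trans _ _ _ h2).trans _ _ _ h3
  convert this using 1
  simp only [aff_apply, add_zero, map_add, lin_lin, tp_tp]
  simp [lin_false_zero, tp_false_zero]
  simp [lin]

theorem Λ_le_G {γ : V} (hγ : γ ∈ Λ 0) : γ ∈ G := by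
  have h1 : ((0, 0, 1) : V) ∈ G := G_step ⟨0, 0, 0, 0, 1, 0, by simp, by simp⟩
    (by rw [ηl_apply]; simp)
  have h2 : ((1, ω₀, 0) : V) ∈ G := G_step ⟨1, 0, 0, 1, 0, 0, by simp, by simp⟩
    (by rw [ηl_apply]; simp [ω_conj]; ring)
  have h3 : ((0, 1 + 2 * ω₀, 0) : V) ∈ G := G_step ⟨0, 0, 1, 2, 0, 0, by simp, by decide⟩
    (by
      have h2 : (starRingEnd ℂ) 2 = 2 := Complex.conj_ofNat 2
      rw [ηl_apply]; simp [ω_conj, h2]; ring)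
  obtain ⟨a₁, b₁, a₂, b₂, a₃, b₃, rfl, hj⟩ := hγ
  rw [ZMod.intCast_zmod_eq_zero_iff_dvd] at hj
  obtain ⟨d, hd⟩ : (3 : ℤ) ∣ (b₂ - a₁ + 2 * b₁) - 2 * (a₂ + b₁) := by
    have : (3 : ℤ) ∣ a₂ + b₂ - a₁ := by exact_mod_cast hj
    omega
  have key := G.add_mem (G.add_mem (G.add_mem (G.zsmul_mem h2 a₁) (G.zsmul_mem (G_Fl h2) b₁))
    (G.add_mem (G.zsmul_mem h1 a₃) (G.zsmul_mem (G_Fl h1) b₃)))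
    (G.add_mem (G.zsmul_mem h3 (a₂ + b₁ + 2 * d)) (G.zsmul_mem (G_Fl h3) d))
  convert key using 1
  have hd' : ((b₂ : ℂ) - a₁ + 2 * b₁) - 2 * (a₂ + b₁) = 3 * d := by exact_mod_cast hd
  simp only [Fl_apply, Prod.smul_mk, Prod.mk_add_mk, Prod.mk.injEq, zsmul_eq_mul]
  push_cast
  refine ⟨by ring, ?_, by ring⟩
  linear_combination ω₀ * hd' + (-b₁ - 2 * d) * ω_sq

theorem generation {x y : ℝ × V} (h : R 0 x y) : C x y := by
  obtain ⟨b, n, γ, hγ, rfl⟩ := h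
  have := (C_lin_zero b n x).trans _ _ _ (Λ_le_G hγ (aff b n 0 x))
  convert this using 1
  simp [aff_apply]

theorem Yc_sc : SimplyConnectedSpace Yc := by
  refine simplyConnected_general pY_open (fun x y h => generation (pY_eq.1 h)) fun x => ?_
  obtain ⟨δ, hδ, H⟩ := exists_cone x
  refine ⟨Metric.ball x δ, Metric.isOpen_ball, convex_ball x δ, Metric.mem_ball_self hδ, ?_⟩
  intro b hb b' hb' hbb
  obtain ⟨-, h, h1, h2, h3⟩ := H 0 b hb b' hb' (pY_eq.1 hbb)
  exact ⟨h, funext fun u => (pY_eq.2 (h1 u)).symm, h2, h3⟩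

end X131

namespace X131

/-! ### The deck transformations -/

/-- The shift by `j` steps in the second coordinate. -/
noncomputable def sh (j : ZMod 3) (x : ℝ × V) : ℝ × V := (x.1, x.2 + (0, (j.val : ℂ), 0))

theorem R_sh (j : ZMod 3) (x : ℝ × V) : R j x (sh j x) := by
  refine ⟨false, 0, (0, (j.val : ℂ), 0), ⟨0, 0, j.val, 0, 0, 0, by simp, by simp⟩, ?_⟩
  rw [lin_false_zero, tp_false_zero]; rfl

theorem R_cancel {i j : ZMod 3} {x y z : ℝ × V} (h : R i x y) (h' : R j x z) : R (j - i) y z := by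
  have := R_trans (R_symm h) h'
  rwa [neg_add_eq_sub] at this

theorem R_sh_iff {j : ZMod 3} {x y : ℝ × V} : R 0 (sh j x) y ↔ R j x y := by
  constructor
  · intro h
    have := R_trans (R_sh j x) h
    rwa [add_zero] at this
  · intro h
    have := R_cancel (R_sh j x) h
    rwa [sub_self] at this

theorem sh_R {j : ZMod 3} {x y : ℝ × V} (h : R 0 x y) : R 0 (sh j x) (sh j y) := by
  rw [R_sh_iff]
  have := R_trans h (R_sh j y)
  rwa [zero_add] at this

noncomputable instance actY : AddAction (ZMod 3) Yc where
  vadd j := Quotient.map (sh j) fun _ _ h => sh_R h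
  zero_vadd y := by
    obtain ⟨x, rfl⟩ := pY_open.surjective y
    exact pY_eq.2 (R_sh_iff.2 (R_refl x))
  add_vadd i j y := by
    obtain ⟨x, rfl⟩ := pY_open.surjective y
    refine pY_eq.2 (R_sh_iff.2 ?_)
    rw [add_comm]
    exact R_trans (R_sh j x) (R_sh i _)

theorem vadd_pY (j : ZMod 3) (x : ℝ × V) : j +ᵥ pY x = pY (sh j x) := rfl

theorem covering_of {X : Type*} [TopologicalSpace X] {P : ℝ × V → X} (hP : Topology.IsQuotientMap P)
    (hPR : ∀ x y, P x = P y ↔ ∃ j, R j x y) :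
    ∃ f : Yc → X, IsAddQuotientCoveringMap f (ZMod 3) := by
  let f : Yc → X := Quotient.lift P fun x y h => (hPR x y).2 ⟨0, h⟩
  have hf : ∀ x, f (pY x) = P x := fun x => rfl
  have hfc : Continuous f := hP.continuous.quotient_lift _
  have hfq : Topology.IsQuotientMap f :=
    Topology.IsQuotientMap.of_comp pY_open.continuous hfc (show Topology.IsQuotientMap (f ∘ pY) from hP)
  refine ⟨f, { toIsQuotientMap := hfq, continuous_const_vadd := ?_, apply_eq_iff_mem_orbit := ?_, disjoint := ?_ }⟩
  · intro j
    refine Continuous.quotient_map' ?_ (fun _ _ h => sh_R h)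
    unfold sh
    fun_prop
  · intro e₁ e₂
    obtain ⟨x, rfl⟩ := pY_open.surjective e₁
    obtain ⟨y, rfl⟩ := pY_open.surjective e₂
    rw [hf, hf, eq_comm, hPR, AddAction.mem_orbit_iff]
    simp only [vadd_pY, pY_eq, R_sh_iff]
  · intro e
    obtain ⟨x, rfl⟩ := pY_open.surjective e
    obtain ⟨δ, hδ, H⟩ := exists_cone x
    refine ⟨pY '' Metric.ball x δ, (pY_open.isOpenMap _ Metric.isOpen_ball).mem_nhds
      ⟨x, Metric.mem_ball_self hδ, rfl⟩, ?_⟩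
    rintro g ⟨_, ⟨_, ⟨b, hb, rfl⟩, h⟩, ⟨b', hb', rfl⟩⟩
    simp only [vadd_pY, pY_eq, R_sh_iff] at h
    exact (H g b hb b' hb' h).1

/-! ### The projection to `X` -/

/-- The projection to the torus. -/
noncomputable def mkV (z : V) : T₁ := (mk₁ z.1, mk₁ z.2.1, mk₁ z.2.2)

theorem mem_Γ {z : ℂ} : z ∈ Γ₁ ↔ ∃ a b : ℤ, z = a + b * ω₀ := by
  rw [Γ₁, AddSubgroup.mem_closure_pair]
  simp [eq_comm]

theorem mkV_eq {z w : V} : mkV z = mkV w ↔ ∃ j, w - z ∈ Λ j := by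
  obtain ⟨z₁, z₂, z₃⟩ := z
  obtain ⟨w₁, w₂, w₃⟩ := w
  simp only [mkV, mk₁, Prod.mk.injEq, QuotientAddGroup.eq, mem_Γ, neg_add_eq_sub]
  constructor
  · rintro ⟨⟨a₁, b₁, h₁⟩, ⟨a₂, b₂, h₂⟩, ⟨a₃, b₃, h₃⟩⟩
    exact ⟨_, a₁, b₁, a₂, b₂, a₃, b₃, by simp [h₁, h₂, h₃], rfl⟩
  · rintro ⟨j, a₁, b₁, a₂, b₂, a₃, b₃, h, -⟩
    simp only [Prod.mk_sub_mk, Prod.mk.injEq] at h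
    exact ⟨⟨a₁, b₁, h.1⟩, ⟨a₂, b₂, h.2.1⟩, ⟨a₃, b₃, h.2.2⟩⟩

theorem mkV_open : IsOpenQuotientMap mkV := by
  have h : IsOpenQuotientMap mk₁ := QuotientAddGroup.isOpenQuotientMap_mk
  exact h.prodMap (h.prodMap h)

/-- The full orbit relation. -/
def RA : Setoid (ℝ × V) where
  r x y := ∃ j, R j x y
  iseqv := ⟨fun x => ⟨0, R_refl x⟩, fun ⟨_, h⟩ => ⟨_, R_symm h⟩,
    fun ⟨_, h⟩ ⟨_, h'⟩ => ⟨_, R_trans h h'⟩⟩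

theorem R_translate {j : ZMod 3} {t : ℝ} {z w : V} (h : w - z ∈ Λ j) : R j (t, z) (t, w) :=
  ⟨false, 0, w - z, h, by rw [lin_false_zero, tp_false_zero]; simp⟩

section Main

variable (F : T₁ → T₁) (κ : Quot (mtRel F) → Quot (mtRel F))

/-- The projection onto `X`. -/
noncomputable def PX (x : ℝ × V) : Quot (fun a b => b = κ a) :=
  Quot.mk _ (Quot.mk (mtRel F) (x.1, mkV x.2))

theorem PX_quot : Topology.IsQuotientMap (PX F κ) :=
  isQuotientMap_quot_mk.comp (isQuotientMap_quot_mk.comp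
    (IsOpenQuotientMap.id.prodMap mkV_open).isQuotientMap)

theorem PX_F (hF : ∀ z, F (mkV z) = mkV (Fl z)) (t : ℝ) (z : V) :
    PX F κ (t + 1, Fl z) = PX F κ (t, z) := by
  refine congrArg (Quot.mk _) (Quot.sound ?_).symm
  simp [mtRel, hF]

theorem PX_κ (hκ : ∀ (t : ℝ) (z : V),
      κ (Quot.mk (mtRel F) (t, mkV z)) = Quot.mk (mtRel F) (1 - t, mkV (ηl z)))
    (t : ℝ) (z : V) : PX F κ (1 - t, ηl z) = PX F κ (t, z) := by
  refine (Quot.sound ?_).symm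
  exact (hκ t z).symm

theorem PX_zpow (hF : ∀ z, F (mkV z) = mkV (Fl z)) (n : ℤ) (t : ℝ) (z : V) :
    PX F κ (t + n, (Fl ^ n) z) = PX F κ (t, z) := by
  induction n with
  | zero => simp
  | succ n ih =>
    rw [← ih, ← PX_F F κ hF (t + (n : ℤ))]
    congr 2
    · push_cast; ring
    · rw [add_comm, zpow_add, zpow_one]; rfl
  | pred n ih =>
    rw [← ih, ← PX_F F κ hF]
    congr 2
    · push_cast; ring
    · change (Fl * Fl ^ (-(n : ℤ) - 1)) z = _
      rw [← zpow_one_add]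
      congr 2
      ring

theorem PX_iff (hF : ∀ z, F (mkV z) = mkV (Fl z))
    (hκ : ∀ (t : ℝ) (z : V),
      κ (Quot.mk (mtRel F) (t, mkV z)) = Quot.mk (mtRel F) (1 - t, mkV (ηl z)))
    (x y : ℝ × V) : PX F κ x = PX F κ y ↔ ∃ j, R j x y := by
  constructor
  · intro h
    let g : ℝ × T₁ → Quotient RA := fun a => Quotient.mk RA (a.1, Function.surjInv mkV_open.surjective a.2)
    have hg : ∀ t z, g (t, mkV z) = Quotient.mk RA (t, z) := by
      intro t z
      refine Quotient.sound ?_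
      obtain ⟨j, hj⟩ := mkV_eq.1 (Function.surjInv_eq mkV_open.surjective (mkV z))
      exact ⟨j, R_translate hj⟩
    let g1 : Quot (mtRel F) → Quotient RA := Quot.lift g (by
      rintro ⟨t, w⟩ b hb
      obtain ⟨z, rfl⟩ := mkV_open.surjective w
      rw [mtRel] at hb
      subst hb
      simp only [hF, hg]
      refine Quotient.sound ⟨0, false, 1, 0, Λ_zero, ?_⟩
      simp [tp, lin])
    let g2 : Quot (fun a b => b = κ a) → Quotient RA := Quot.lift g1 (by
      rintro a b rfl
      obtain ⟨⟨t, w⟩, rfl⟩ := Quot.exists_rep a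
      obtain ⟨z, rfl⟩ := mkV_open.surjective w
      rw [hκ]
      change g _ = g _
      rw [hg, hg]
      refine Quotient.sound ⟨0, true, 0, 0, Λ_zero, ?_⟩
      simp [tp, lin])
    have hg2 : ∀ u, g2 (PX F κ u) = Quotient.mk RA u := fun u => hg u.1 u.2
    have h2 := congrArg g2 h
    rw [hg2, hg2] at h2
    exact Quotient.exact h2
  · rintro ⟨j, b, n, γ, hγ, rfl⟩
    have h1 : PX F κ (tp b n x.1, lin b n x.2 + γ) = PX F κ (tp b n x.1, lin b n x.2) := by
      have : mkV (lin b n x.2 + γ) = mkV (lin b n x.2) :=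
        (mkV_eq.2 ⟨j, by simpa using hγ⟩).symm
      simp only [PX, this]
    rw [h1]
    cases b
    · exact (PX_zpow F κ hF n x.1 x.2).symm
    · rw [← PX_κ F κ hκ x.1 x.2, ← PX_zpow F κ hF n]
      congr 2
      simp [tp]; ring

end Main

end X131

/-- Let `F : T → T` be induced by `z ↦ (ωz₁, ωz₂ − ωz₁, ωz₃)`, `M` the mapping torus of
`F`, `κ[t,x] = [1−t, η x]` with `η` induced by `z ↦ (−z̄₁, z̄₂ + z̄₁, −z̄₃)`, and
`X = M/κ`. Then `X` is path-connected with fundamental group `ℤ/3ℤ`. -/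
theorem fundamental_group_X131 (F : T₁ → T₁)
    (hF : ∀ z₁ z₂ z₃ : ℂ,
      F (mk₁ z₁, mk₁ z₂, mk₁ z₃) =
        (mk₁ (ω₀ * z₁), mk₁ (ω₀ * z₂ - ω₀ * z₁), mk₁ (ω₀ * z₃)))
    (κ : Quot (mtRel F) → Quot (mtRel F))
    (hκ : ∀ (t : ℝ) (z₁ z₂ z₃ : ℂ),
      κ (Quot.mk (mtRel F) (t, (mk₁ z₁, mk₁ z₂, mk₁ z₃))) =
        Quot.mk (mtRel F)
          (1 - t, (mk₁ (-(star z₁)), mk₁ (star z₂ + star z₁), mk₁ (-(star z₃))))) :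
    PathConnectedSpace (Quot (fun a b => b = κ a)) ∧
      ∀ x : Quot (fun a b => b = κ a),
        Nonempty (FundamentalGroup (Quot (fun a b => b = κ a)) x ≃*
          Multiplicative (ZMod 3)) := by
  have hq := X131.PX_quot F κ
  refine ⟨hq.surjective.pathConnectedSpace hq.continuous, fun x => ?_⟩
  obtain ⟨f, hf⟩ := X131.covering_of hq (X131.PX_iff F κ (fun z => hF z.1 z.2.1 z.2.2)
    (fun t z => hκ t z.1 z.2.1 z.2.2))
  obtain ⟨e, he⟩ := hf.surjective x
  haveI := X131.Yc_sc
  exact ⟨(hf.fundamentalGroupEquiv ⟨e, he⟩).trans MulOpposite.opMulEquiv.symm⟩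
end

section
/- Let Γ₁ = ℤ + ℤω ⊂ ℂ with ω = exp(2πi/3) and u = exp(πi/3), let T = (ℂ/Γ₁)³, let F : T → T be induced by z ↦ (uz₁, uz₂ − uz₁, exp(−2πi/3)z₃), let M be the mapping torus of F, let κ : M → M be κ[t,x] = [1−t, η(x)] with η : T → T induced by z ↦ (−z̄₁, z̄₂ + z̄₁, −z̄₃), and let X = M/κ be the quotient topological space. Then X is simply connected (path-connected with trivial fundamental group). -/
/-- The primitive sixth root of unity `u = exp(πi/3)`. -/
noncomputable def u₀ : ℂ := Complex.exp (Real.pi * Complex.I / 3)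

open Topology unitInterval in
theorem quo_contractible {Y X : Type*} [NormedAddCommGroup Y] [NormedSpace ℝ Y] [TopologicalSpace X]
    (G : Subgroup (Equiv.Perm Y)) (q : Y → X) (hq : IsOpenQuotientMap q)
    (hfib : ∀ y y', q y = q y' ↔ ∃ g ∈ G, g y = y')
    (haff : ∀ g ∈ G, ∀ (a b : Y) (s : ℝ), g ((1 - s) • a + s • b) = (1 - s) • g a + s • g b)
    (y : Y) (W : Set Y) (hW : IsOpen W) (hWc : Convex ℝ W) (hy : y ∈ W)
    (hpd : ∀ g ∈ G, ∀ w ∈ W, g w ∈ W → g y = y) :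
    ContractibleSpace (q '' W) := by
  let r0 : W → q '' W := fun w => ⟨q w, w, w.2, rfl⟩
  have hr0c : Continuous r0 := (hq.continuous.comp continuous_subtype_val).subtype_mk _
  have hr0 : IsOpenQuotientMap r0 := by
    refine ⟨?_, hr0c, ?_⟩
    · rintro ⟨_, w, hw, rfl⟩; exact ⟨⟨w, hw⟩, rfl⟩
    · have h1 : IsOpenMap (fun w : W => q w) := hq.isOpenMap.comp hW.isOpenMap_subtype_val
      exact h1.subtype_mk _
  have hr : IsOpenQuotientMap (Prod.map (id : I → I) r0) := IsOpenQuotientMap.id.prodMap hr0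
  have hmem : ∀ (s : I) (w : W), ((1 - (s : ℝ)) • (w : Y) + (s : ℝ) • y) ∈ W := by
    intro s w
    exact hWc w.2 hy (by linarith [s.2.2]) s.2.1 (by ring)
  let f : C(I × W, q '' W) := ⟨fun p => r0 ⟨_, hmem p.1 p.2⟩, by
    apply hr0c.comp
    apply Continuous.subtype_mk
    fun_prop⟩
  let r : C(I × W, I × (q '' W)) := ⟨_, hr.continuous⟩
  have hrq : IsQuotientMap r := hr.isQuotientMap
  have hf : ∀ a b, r a = r b → f a = f b := by
    rintro ⟨s, w⟩ ⟨s', w'⟩ h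
    have h1 : s = s' := congrArg Prod.fst h
    have h2 : q w = q w' := congrArg (fun z => (z.2 : X)) h
    subst h1
    obtain ⟨g, hg, hgw⟩ := (hfib _ _).1 h2
    have hgy := hpd g hg w w.2 (by rw [hgw]; exact w'.2)
    apply Subtype.ext
    change q _ = q _
    rw [hfib]
    exact ⟨g, hg, by rw [haff g hg, hgw, hgy]⟩
  let F : C(I × (q '' W), q '' W) := hrq.lift f hf
  have hF : ∀ s w, F (s, r0 w) = f (s, w) := by
    intro s w
    have := hrq.lift_comp f hf
    exact DFunLike.congr_fun this (s, w)
  rw [contractible_iff_id_nullhomotopic]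
  refine ⟨r0 ⟨y, hy⟩, ⟨⟨F, ?_, ?_⟩⟩⟩
  · intro x
    obtain ⟨w, rfl⟩ := hr0.surjective x
    change F (0, r0 w) = r0 w
    rw [hF]
    change r0 _ = r0 _
    congr 1
    apply Subtype.ext
    simp
  · intro x
    obtain ⟨w, rfl⟩ := hr0.surjective x
    change F (1, r0 w) = r0 _
    rw [hF]
    change r0 _ = r0 _
    congr 1
    apply Subtype.ext
    simp

/-- A path lifts up to homotopy. -/
def HLift {Y X : Type*} [TopologicalSpace Y] [TopologicalSpace X] {q : Y → X} (hq : Continuous q)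
    {a b : X} (γ : Path a b) : Prop :=
  ∀ y, ∀ hy : q y = a, ∃ y', ∃ hy' : q y' = b, ∃ p : Path y y',
    ((p.map hq).cast hy.symm hy'.symm).Homotopic γ

theorem HLift.trans {Y X : Type*} [TopologicalSpace Y] [TopologicalSpace X] {q : Y → X}
    {hq : Continuous q} {a b c : X} {γ : Path a b} {δ : Path b c} (h1 : HLift hq γ)
    (h2 : HLift hq δ) : HLift hq (γ.trans δ) := by
  intro y hy
  obtain ⟨y', hy', p, hp⟩ := h1 y hy
  obtain ⟨y'', hy'', p', hp'⟩ := h2 y' hy'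
  subst hy hy' hy''
  refine ⟨y'', rfl, p.trans p', ?_⟩
  have := hp.hcomp hp'
  simpa [Path.map_trans] using this

theorem HLift.congr {Y X : Type*} [TopologicalSpace Y] [TopologicalSpace X] {q : Y → X}
    {hq : Continuous q} {a b : X} {γ δ : Path a b} (h1 : HLift hq γ)
    (h : γ.Homotopic δ) : HLift hq δ := by
  intro y hy
  obtain ⟨y', hy', p, hp⟩ := h1 y hy
  exact ⟨y', hy', p, hp.trans h⟩

/-- A path contained in a small open set lifts. -/
theorem HLift.small {Y X : Type*} [NormedAddCommGroup Y] [NormedSpace ℝ Y] [TopologicalSpace X]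
    (G : Subgroup (Equiv.Perm Y)) (q : Y → X) (hq : IsOpenQuotientMap q)
    (hfib : ∀ y y', q y = q y' ↔ ∃ g ∈ G, g y = y')
    (hcont : ∀ g ∈ G, Continuous g)
    (W : Set Y) (hWc : Convex ℝ W)
    [ContractibleSpace (q '' W)] {a b : X} (γ : Path a b) (hγ : Set.range γ ⊆ q '' W) :
    HLift hq.continuous γ := by
  intro y hy
  obtain ⟨w, hw, hwa⟩ : a ∈ q '' W := by simpa using hγ ⟨0, rfl⟩
  obtain ⟨w', hw', hwb⟩ : b ∈ q '' W := by simpa using hγ ⟨1, rfl⟩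
  obtain ⟨g, hg, hgw⟩ := (hfib w y).1 (hwa.trans hy.symm)
  have hqg : ∀ z, q (g z) = q z := fun z => ((hfib _ _).2 ⟨g, hg, rfl⟩).symm
  subst hwa hwb hgw
  have : PathConnectedSpace W :=
    isPathConnected_iff_pathConnectedSpace.1 (hWc.isPathConnected ⟨w, hw⟩)
  let p : Path (⟨w, hw⟩ : W) ⟨w', hw'⟩ := PathConnectedSpace.somePath _ _
  have hpc : Continuous fun z : W => g z := (hcont g hg).comp continuous_subtype_val
  refine ⟨g w', hqg w', p.map hpc, ?_⟩
  have hr0c : Continuous (fun w : W => (⟨q w, w, w.2, rfl⟩ : q '' W)) :=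
    (hq.continuous.comp continuous_subtype_val).subtype_mk _
  let γ' : Path (⟨q w, w, hw, rfl⟩ : q '' W) ⟨q w', w', hw', rfl⟩ :=
    { toFun := fun t => ⟨γ t, hγ ⟨t, rfl⟩⟩
      continuous_toFun := γ.continuous.subtype_mk _
      source' := by simp
      target' := by simp }
  have h := (SimplyConnectedSpace.paths_homotopic (p.map hr0c) γ').map
    ⟨Subtype.val, continuous_subtype_val⟩
  have e : ((p.map hpc).map hq.continuous).cast (hqg w).symm (hqg w').symm =
      ((p.map hr0c).map continuous_subtype_val : Path (q w) (q w')) := by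
    ext t
    exact hqg _
  rw [e]
  exact h

theorem HLift.all {Y X : Type*} [NormedAddCommGroup Y] [NormedSpace ℝ Y] [TopologicalSpace X]
    (G : Subgroup (Equiv.Perm Y)) (q : Y → X) (hq : IsOpenQuotientMap q)
    (hfib : ∀ y y', q y = q y' ↔ ∃ g ∈ G, g y = y')
    (hcont : ∀ g ∈ G, Continuous g)
    (haff : ∀ g ∈ G, ∀ (a b : Y) (s : ℝ), g ((1 - s) • a + s • b) = (1 - s) • g a + s • g b)
    (hpd : ∀ y, ∃ W : Set Y, IsOpen W ∧ Convex ℝ W ∧ y ∈ W ∧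
      ∀ g ∈ G, ∀ w ∈ W, g w ∈ W → g y = y)
    {a b : X} (γ : Path a b) : HLift hq.continuous γ := by
  choose W hWo hWc hyW hW using hpd
  obtain ⟨t, ht0, htm, ⟨n, hn⟩, hi⟩ := exists_monotone_Icc_subset_open_cover_unitInterval
    (c := fun y => γ ⁻¹' (q '' W y)) (fun y => (hq.isOpenMap _ (hWo y)).preimage γ.continuous)
    (by
      intro s _
      obtain ⟨y, hy⟩ := hq.surjective (γ s)
      exact Set.mem_iUnion.2 ⟨y, y, hyW y, hy⟩)
  have key : ∀ m, HLift hq.continuous (γ.subpath (t 0) (t m)) := by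
    intro m
    induction m with
    | zero =>
      rw [Path.subpath_self]
      intro y hy
      refine ⟨y, hy, Path.refl y, ?_⟩
      convert Path.Homotopic.refl _ using 1
      ext s
      simp [hy]
    | succ m ih =>
      refine HLift.congr (HLift.trans ih ?_) ⟨Path.Homotopy.subpathTransSubpath γ _ (t m) _⟩
      obtain ⟨y, hy⟩ := hi m
      have := quo_contractible G q hq hfib haff y (W y) (hWo y) (hWc y) (hyW y) (hW y)
      apply HLift.small G q hq hfib hcont (W y) (hWc y)
      rw [Path.range_subpath_of_le _ _ _ (htm (Nat.le_succ m))]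
      exact Set.image_subset_iff.2 hy
  have h1 := key n
  rw [ht0, hn n le_rfl, Path.subpath_zero_one] at h1
  intro y hy
  obtain ⟨y', hy', p, hp⟩ := h1 y (by simpa using hy)
  refine ⟨y', by simpa using hy', p, ?_⟩
  exact hp.pathCast γ.source.symm γ.target.symm

/-- An element acts trivially on homotopy classes downstairs. -/
def NullElt {Y X : Type*} [TopologicalSpace Y] [TopologicalSpace X] {q : Y → X} (hq : Continuous q)
    (g : Equiv.Perm Y) : Prop :=
  ∀ y y', g y = y' → ∀ h : q y' = q y, ∀ p : Path y y',
    ((p.map hq).cast rfl h.symm).Homotopic (Path.refl _)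

theorem quo_simplyConnected {Y X : Type*} [NormedAddCommGroup Y] [NormedSpace ℝ Y]
    [TopologicalSpace X]
    (G : Subgroup (Equiv.Perm Y)) (q : Y → X) (hq : IsOpenQuotientMap q)
    (hfib : ∀ y y', q y = q y' ↔ ∃ g ∈ G, g y = y')
    (hcont : ∀ g ∈ G, Continuous g)
    (haff : ∀ g ∈ G, ∀ (a b : Y) (s : ℝ), g ((1 - s) • a + s • b) = (1 - s) • g a + s • g b)
    (hpd : ∀ y, ∃ W : Set Y, IsOpen W ∧ Convex ℝ W ∧ y ∈ W ∧
      ∀ g ∈ G, ∀ w ∈ W, g w ∈ W → g y = y)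
    (hgen : G ≤ Subgroup.closure {g | g ∈ G ∧ ∃ p, g p = p}) :
    SimplyConnectedSpace X := by
  have hqg : ∀ g ∈ G, ∀ z, q (g z) = q z := fun g hg z => ((hfib _ _).2 ⟨g, hg, rfl⟩).symm
  have hle : Subgroup.closure {g | g ∈ G ∧ ∃ p, g p = p} ≤ G := by
    rw [Subgroup.closure_le]; exact fun g hg => hg.1
  have hnull : ∀ g ∈ Subgroup.closure {g | g ∈ G ∧ ∃ p, g p = p}, NullElt hq.continuous g := by
    intro g hg
    induction hg using Subgroup.closure_induction with
    | mem g hg =>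
      obtain ⟨hg, z, hz⟩ := hg
      intro y y' hy h p
      subst hy
      let c : Path y z := PathConnectedSpace.somePath _ _
      let c' : Path (g y) z := (c.map (hcont g hg)).cast rfl hz.symm
      have h1 := (SimplyConnectedSpace.paths_homotopic p (c.trans c'.symm)).map ⟨q, hq.continuous⟩
      have h2 := h1.pathCast rfl h.symm
      refine h2.trans ?_
      have h3 : (c.map hq.continuous).trans (c.map hq.continuous).symm
        = ((c.trans c'.symm).map hq.continuous).cast rfl h.symm := by
        ext s
        simp only [Path.map_trans, Path.cast_coe, Path.trans_apply]
        split_ifs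
        · rfl
        · simp [c', hqg g hg]
      change Path.Homotopic (((c.trans c'.symm).map hq.continuous).cast rfl h.symm) _
      rw [← h3]
      exact ⟨(Path.Homotopy.reflTransSymm _).symm⟩
    | one =>
      intro y y' hy h p
      have : y = y' := hy
      subst this
      exact (SimplyConnectedSpace.paths_homotopic p (Path.refl _)).map ⟨q, hq.continuous⟩
    | mul g k hg hk ihg ihk =>
      intro y y' hy h p
      have hky := hqg k (hle hk) y
      let c : Path y (k y) := PathConnectedSpace.somePath _ _
      let c' : Path (k y) y' := PathConnectedSpace.somePath _ _
      have e1 := ihk y _ rfl hky c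
      have e2 := ihg (k y) y' hy (h.trans hky.symm) c'
      have h1 := (SimplyConnectedSpace.paths_homotopic p (c.trans c')).map ⟨q, hq.continuous⟩
      have h2 := h1.pathCast rfl h.symm
      refine h2.trans ?_
      have e3 := e1.hcomp (e2.pathCast hky.symm hky.symm)
      have h3 : ((c.map hq.continuous).cast rfl hky.symm).trans
          (((c'.map hq.continuous).cast rfl (h.trans hky.symm).symm).cast hky.symm hky.symm)
        = ((c.trans c').map hq.continuous).cast rfl h.symm := by
        ext s
        simp only [Path.map_trans, Path.cast_coe, Path.trans_apply]
      rw [h3] at e3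
      refine Path.Homotopic.trans e3 ?_
      have h4 : (Path.refl (q y)).trans ((Path.refl (q (k y))).cast hky.symm hky.symm)
        = Path.refl (q y) := by
        ext s
        simp [Path.trans_apply, hky]
      rw [h4]
    | inv g hg ih =>
      intro y y' hy h p
      have hy' : g y' = y := by rw [← hy]; simp
      have e := (ih y' y hy' h.symm p.symm).symm₂.pathCast h.symm h.symm
      convert e using 1
      · ext s; simp
      · ext s; simp [h]
  rw [simply_connected_iff_loops_nullhomotopic]
  refine ⟨hq.surjective.pathConnectedSpace hq.continuous, ?_⟩
  intro x γ
  obtain ⟨y, rfl⟩ := hq.surjective x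
  obtain ⟨y', hy', p, hp⟩ := HLift.all G q hq hfib hcont haff hpd γ y rfl
  obtain ⟨g, hg, hgy⟩ := (hfib _ _).1 hy'.symm
  exact hp.symm.trans (hnull g (hgen hg) y y' hgy hy' p)

/-! ### Arithmetic of the Eisenstein lattice -/

theorem u₀_eq : u₀ = ⟨1 / 2, Real.sqrt 3 / 2⟩ := by
  have : u₀ = Complex.exp (((Real.pi / 3 : ℝ) : ℂ) * Complex.I) := by
    unfold u₀; congr 1; push_cast; ring
  rw [this, Complex.exp_mul_I, ← Complex.ofReal_cos, ← Complex.ofReal_sin, Real.cos_pi_div_three,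
    Real.sin_pi_div_three]
  apply Complex.ext <;> simp

theorem u₀_sq : u₀ * u₀ = u₀ - 1 := by
  have h3 : Real.sqrt 3 * Real.sqrt 3 = 3 := Real.mul_self_sqrt (by norm_num)
  rw [u₀_eq]
  apply Complex.ext
  · simp; linarith
  · simp; ring

theorem star_u₀ : star u₀ = 1 - u₀ := by
  rw [u₀_eq]
  apply Complex.ext <;> simp
  norm_num

theorem u₀_ne : u₀ ≠ 0 := Complex.exp_ne_zero _

theorem u₀_inv : u₀⁻¹ = 1 - u₀ := by
  have := u₀_ne
  field_simp
  linear_combination u₀_sq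

theorem star_u₀_inv : star u₀ = u₀⁻¹ := by rw [star_u₀, u₀_inv]

theorem ω₀_eq : ω₀ = u₀ - 1 := by
  rw [← u₀_sq]; unfold ω₀ u₀
  rw [← Complex.exp_add]; congr 1; ring

theorem exp_eq : Complex.exp (-(2 * Real.pi * Complex.I) / 3) = -u₀ := by
  have : -(2 * Real.pi * Complex.I) / 3 = Real.pi * Complex.I / 3 - Real.pi * Complex.I := by ring
  rw [this, Complex.exp_sub, Complex.exp_pi_mul_I]
  rw [div_neg, div_one, u₀]

theorem mem_Γ {x : ℂ} : x ∈ Γ₁ ↔ ∃ m n : ℤ, x = m + n * u₀ := by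
  unfold Γ₁
  rw [AddSubgroup.mem_closure_pair]
  constructor
  · rintro ⟨m, n, rfl⟩
    refine ⟨m - n, n, ?_⟩
    rw [ω₀_eq]; push_cast; simp only [zsmul_eq_mul]; ring
  · rintro ⟨m, n, rfl⟩
    refine ⟨m + n, n, ?_⟩
    rw [ω₀_eq]; simp only [zsmul_eq_mul]; push_cast; ring

theorem u_mem {x : ℂ} (h : x ∈ Γ₁) : u₀ * x ∈ Γ₁ := by
  rw [mem_Γ] at *
  obtain ⟨m, n, rfl⟩ := h
  refine ⟨-n, m + n, ?_⟩
  push_cast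
  linear_combination (n : ℂ) * u₀_sq

theorem uinv_mem {x : ℂ} (h : x ∈ Γ₁) : u₀⁻¹ * x ∈ Γ₁ := by
  rw [u₀_inv, sub_mul, one_mul]
  exact sub_mem h (u_mem h)

theorem star_mem' {x : ℂ} (h : x ∈ Γ₁) : star x ∈ Γ₁ := by
  rw [mem_Γ] at *
  obtain ⟨m, n, rfl⟩ := h
  refine ⟨m + n, -n, ?_⟩
  simp only [star_add, star_mul', star_intCast, star_u₀]
  push_cast
  ring

theorem norm_Γ {x : ℂ} (h : x ∈ Γ₁) (hx : ‖x‖ < 1) : x = 0 := by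
  obtain ⟨m, n, rfl⟩ := mem_Γ.1 h
  have h3 : Real.sqrt 3 * Real.sqrt 3 = 3 := Real.mul_self_sqrt (by norm_num)
  have h1 : Complex.normSq (m + n * u₀) = ((m * m + m * n + n * n : ℤ) : ℝ) := by
    rw [u₀_eq, Complex.normSq_apply]
    simp
    linear_combination (n * n / 4 : ℝ) * h3
  have h2 : Complex.normSq (m + n * u₀) < 1 := by
    rw [Complex.normSq_eq_norm_sq]
    have := norm_nonneg ((m : ℂ) + n * u₀)
    nlinarith
  rw [h1] at h2
  have h4 : m * m + m * n + n * n < 1 := by exact_mod_cast h2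
  have hn : n = 0 := by
    by_contra hn
    have : 0 < n * n := mul_self_pos.2 hn
    nlinarith [sq_nonneg (2 * m + n)]
  subst hn
  have hm : m = 0 := by
    by_contra hm
    have : 0 < m * m := mul_self_pos.2 hm
    nlinarith
  subst hm
  simp

open Topology in
theorem Γ_disc (c : ℂ) : ∀ᶠ x in 𝓝 c, x ∈ Γ₁ → x = c := by
  by_cases h : ∃ v ∈ Γ₁, ‖v - c‖ < 1 / 2 ∧ v ≠ c
  · obtain ⟨v, hv, hvc, hne⟩ := h
    have hpos : 0 < ‖v - c‖ := norm_pos_iff.2 (sub_ne_zero.2 hne)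
    filter_upwards [Metric.ball_mem_nhds c hpos] with x hx hxΓ
    rw [Metric.mem_ball, dist_eq_norm] at hx
    exfalso
    have : x - v = 0 := by
      apply norm_Γ (sub_mem hxΓ hv)
      calc ‖x - v‖ = ‖(x - c) - (v - c)‖ := by congr 1; ring
        _ ≤ ‖x - c‖ + ‖v - c‖ := norm_sub_le _ _
        _ < 1 := by linarith
    rw [sub_eq_zero.1 this] at hx
    exact lt_irrefl _ hx
  · push Not at h
    filter_upwards [Metric.ball_mem_nhds c (by norm_num : (0 : ℝ) < 1 / 2)] with x hx hxΓ
    exact h x hxΓ (by rwa [Metric.mem_ball, dist_eq_norm] at hx)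

open Topology in
theorem int_disc (c : ℝ) : ∃ N : ℤ, ∀ᶠ x : ℝ in 𝓝 c, ∀ n : ℤ, x = (n : ℝ) + 1 → n = N ∧ x = c := by
  by_cases h : ∃ N : ℤ, c = N + 1
  · obtain ⟨N, rfl⟩ := h
    refine ⟨N, ?_⟩
    filter_upwards [Metric.ball_mem_nhds ((N : ℝ) + 1) one_pos] with x hx n hn
    rw [Metric.mem_ball, Real.dist_eq, hn, abs_lt] at hx
    have h1 : (n : ℝ) < N + 1 := by linarith
    have h2 : (N : ℝ) < n + 1 := by linarith
    have h3 : n = N := by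
      have h1' : n < N + 1 := by exact_mod_cast h1
      have h2' : N < n + 1 := by exact_mod_cast h2
      omega
    exact ⟨h3, by rw [hn, h3]⟩
  · refine ⟨0, ?_⟩
    have hc : c ∈ (Set.range ((↑) : ℤ → ℝ))ᶜ := by
      rintro ⟨m, hm⟩
      exact h ⟨m - 1, by rw [← hm]; push_cast; ring⟩
    filter_upwards [Int.isClosedEmbedding_coe_real.isClosed_range.isOpen_compl.mem_nhds hc]
      with x hx n hn
    exact absurd ⟨n + 1, by rw [hn]; push_cast; rfl⟩ hx

/-! ### The group -/

/-- The universal cover. -/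
abbrev Y₁ : Type := ℝ × ℂ × ℂ × ℂ

/-- Normal form of orientation preserving (in `t`) elements. -/
noncomputable def EE (n : ℤ) (a b c : ℂ) (y : Y₁) : Y₁ :=
  (y.1 + n, u₀ ^ n * y.2.1 + a, u₀ ^ n * y.2.2.1 - n * u₀ ^ n * y.2.1 + b,
    (-u₀) ^ n * y.2.2.2 + c)

/-- Normal form of orientation reversing (in `t`) elements. -/
noncomputable def EE' (n : ℤ) (a b c : ℂ) (y : Y₁) : Y₁ :=
  (n + 1 - y.1, u₀ ^ n * (-star y.2.1) + a,
    u₀ ^ n * (star y.2.2.1 + star y.2.1) + n * u₀ ^ n * star y.2.1 + b,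
    (-u₀) ^ n * (-star y.2.2.2) + c)

/-- The lift of `(t, x) ↦ (t + 1, F x)`. -/
noncomputable def tauP : Equiv.Perm Y₁ where
  toFun y := (y.1 + 1, u₀ * y.2.1, u₀ * y.2.2.1 - u₀ * y.2.1, (-u₀) * y.2.2.2)
  invFun y := (y.1 - 1, u₀⁻¹ * y.2.1, u₀⁻¹ * (y.2.2.1 + y.2.1), (-u₀)⁻¹ * y.2.2.2)
  left_inv y := by
    have := u₀_ne
    ext <;> simp <;> field_simp
  right_inv y := by
    have := u₀_ne
    ext <;> simp <;> field_simp <;> simp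

/-- The lift of `κ`. -/
noncomputable def kapP : Equiv.Perm Y₁ where
  toFun y := (1 - y.1, -star y.2.1, star y.2.2.1 + star y.2.1, -star y.2.2.2)
  invFun y := (1 - y.1, -star y.2.1, star y.2.2.1 + star y.2.1, -star y.2.2.2)
  left_inv y := by ext <;> simp
  right_inv y := by ext <;> simp

/-- Translations. -/
noncomputable def traP (a b c : ℂ) : Equiv.Perm Y₁ where
  toFun y := (y.1, y.2.1 + a, y.2.2.1 + b, y.2.2.2 + c)
  invFun y := (y.1, y.2.1 - a, y.2.2.1 - b, y.2.2.2 - c)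
  left_inv y := by ext <;> simp
  right_inv y := by ext <;> simp

theorem tauP_apply (y : Y₁) :
    tauP y = (y.1 + 1, u₀ * y.2.1, u₀ * y.2.2.1 - u₀ * y.2.1, (-u₀) * y.2.2.2) := rfl
theorem tauP_inv_apply (y : Y₁) :
    tauP⁻¹ y = (y.1 - 1, u₀⁻¹ * y.2.1, u₀⁻¹ * (y.2.2.1 + y.2.1), (-u₀)⁻¹ * y.2.2.2) := rfl
theorem kapP_apply (y : Y₁) :
    kapP y = (1 - y.1, -star y.2.1, star y.2.2.1 + star y.2.1, -star y.2.2.2) := rfl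
theorem kapP_inv_apply (y : Y₁) :
    kapP⁻¹ y = (1 - y.1, -star y.2.1, star y.2.2.1 + star y.2.1, -star y.2.2.2) := rfl
theorem traP_apply (a b c : ℂ) (y : Y₁) :
    traP a b c y = (y.1, y.2.1 + a, y.2.2.1 + b, y.2.2.2 + c) := rfl
theorem traP_inv_apply (a b c : ℂ) (y : Y₁) :
    (traP a b c)⁻¹ y = (y.1, y.2.1 - a, y.2.2.1 - b, y.2.2.2 - c) := rfl

/-- Generators. -/
def gens : Set (Equiv.Perm Y₁) :=
  {g | g = tauP ∨ g = kapP ∨ ∃ a ∈ Γ₁, ∃ b ∈ Γ₁, ∃ c ∈ Γ₁, g = traP a b c}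

/-- The deck group. -/
def GG : Subgroup (Equiv.Perm Y₁) := Subgroup.closure gens

/-- Normal form predicate. -/
def NF (g : Equiv.Perm Y₁) : Prop :=
  ∃ n : ℤ, ∃ a ∈ Γ₁, ∃ b ∈ Γ₁, ∃ c ∈ Γ₁, (∀ y, g y = EE n a b c y) ∨ (∀ y, g y = EE' n a b c y)

theorem star_zpow_u (n : ℤ) : star (u₀ ^ n) = u₀ ^ (-n) := by
  rw [star_zpow₀, star_u₀_inv, inv_zpow, zpow_neg]

theorem star_zpow_nu (n : ℤ) : star ((-u₀) ^ n) = (-u₀) ^ (-n) := by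
  rw [star_zpow₀, star_neg, star_u₀_inv, ← inv_neg, inv_zpow, zpow_neg]

theorem NF_tau {g : Equiv.Perm Y₁} (h : NF g) : NF (tauP * g) := by
  obtain ⟨n, a, ha, b, hb, c, hc, h⟩ := h
  have hu := u₀_ne
  have hnu : -u₀ ≠ 0 := neg_ne_zero.2 hu
  refine ⟨n + 1, u₀ * a, u_mem ha, u₀ * b - u₀ * a, sub_mem (u_mem hb) (u_mem ha), -u₀ * c,
    by rw [neg_mul]; exact neg_mem (u_mem hc), ?_⟩
  rcases h with h | h
  · left
    intro y
    rw [Equiv.Perm.mul_apply, h, tauP_apply]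
    simp only [EE, zpow_add_one₀ hu, zpow_add_one₀ hnu, Prod.mk.injEq]
    push_cast
    refine ⟨?_, ?_, ?_, ?_⟩ <;> ring
  · right
    intro y
    rw [Equiv.Perm.mul_apply, h, tauP_apply]
    simp only [EE', zpow_add_one₀ hu, zpow_add_one₀ hnu, Prod.mk.injEq]
    push_cast
    refine ⟨?_, ?_, ?_, ?_⟩ <;> ring

theorem NF_tau_inv {g : Equiv.Perm Y₁} (h : NF g) : NF (tauP⁻¹ * g) := by
  obtain ⟨n, a, ha, b, hb, c, hc, h⟩ := h
  have hu := u₀_ne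
  have hnu : -u₀ ≠ 0 := neg_ne_zero.2 hu
  refine ⟨n - 1, u₀⁻¹ * a, uinv_mem ha, u₀⁻¹ * (b + a), uinv_mem (add_mem hb ha), (-u₀)⁻¹ * c,
    by rw [inv_neg, neg_mul]; exact neg_mem (uinv_mem hc), ?_⟩
  rcases h with h | h
  · left
    intro y
    rw [Equiv.Perm.mul_apply, h, tauP_inv_apply]
    simp only [EE, zpow_sub_one₀ hu, zpow_sub_one₀ hnu, Prod.mk.injEq]
    push_cast
    refine ⟨?_, ?_, ?_, ?_⟩ <;> ring
  · right
    intro y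
    rw [Equiv.Perm.mul_apply, h, tauP_inv_apply]
    simp only [EE', zpow_sub_one₀ hu, zpow_sub_one₀ hnu, Prod.mk.injEq]
    push_cast
    refine ⟨?_, ?_, ?_, ?_⟩ <;> ring

theorem NF_kap {g : Equiv.Perm Y₁} (h : NF g) : NF (kapP * g) := by
  obtain ⟨n, a, ha, b, hb, c, hc, h⟩ := h
  refine ⟨-n, -star a, neg_mem (star_mem' ha), star b + star a,
    add_mem (star_mem' hb) (star_mem' ha), -star c, neg_mem (star_mem' hc), ?_⟩
  rcases h with h | h
  · right
    intro y
    rw [Equiv.Perm.mul_apply, h, kapP_apply]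
    simp only [EE, EE', star_add, star_sub, star_mul', star_zpow_u, star_zpow_nu, star_intCast,
      Prod.mk.injEq]
    push_cast
    refine ⟨?_, ?_, ?_, ?_⟩ <;> ring
  · left
    intro y
    rw [Equiv.Perm.mul_apply, h, kapP_apply]
    simp only [EE, EE', star_add, star_mul', star_zpow_u, star_zpow_nu, star_intCast,
      star_neg, star_star, Prod.mk.injEq]
    push_cast
    refine ⟨?_, ?_, ?_, ?_⟩ <;> ring

theorem NF_tra {g : Equiv.Perm Y₁} (h : NF g) {a' b' c' : ℂ} (ha' : a' ∈ Γ₁) (hb' : b' ∈ Γ₁)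
    (hc' : c' ∈ Γ₁) : NF (traP a' b' c' * g) := by
  obtain ⟨n, a, ha, b, hb, c, hc, h⟩ := h
  refine ⟨n, a + a', add_mem ha ha', b + b', add_mem hb hb', c + c', add_mem hc hc', ?_⟩
  rcases h with h | h
  · left
    intro y
    rw [Equiv.Perm.mul_apply, h, traP_apply]
    simp only [EE, add_assoc]
  · right
    intro y
    rw [Equiv.Perm.mul_apply, h, traP_apply]
    simp only [EE', add_assoc]

theorem traP_inv (a b c : ℂ) : (traP a b c)⁻¹ = traP (-a) (-b) (-c) := by
  ext1 y
  rw [traP_inv_apply, traP_apply]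
  simp only [sub_eq_add_neg]

theorem NF_GG {g : Equiv.Perm Y₁} (hg : g ∈ GG) : NF g := by
  induction hg using Subgroup.closure_induction_left with
  | one =>
    refine ⟨0, 0, zero_mem _, 0, zero_mem _, 0, zero_mem _, Or.inl ?_⟩
    intro y
    simp [EE]
  | mul_left x hx y hy ih =>
    rcases hx with rfl | rfl | ⟨a, ha, b, hb, c, hc, rfl⟩
    · exact NF_tau ih
    · exact NF_kap ih
    · exact NF_tra ih ha hb hc
  | inv_mul_cancel x hx y hy ih =>
    rcases hx with rfl | rfl | ⟨a, ha, b, hb, c, hc, rfl⟩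
    · exact NF_tau_inv ih
    · exact NF_kap ih
    · rw [traP_inv]
      exact NF_tra ih (neg_mem ha) (neg_mem hb) (neg_mem hc)

theorem GG_cont : ∀ g ∈ GG, Continuous g := by
  intro g hg
  obtain ⟨n, a, -, b, -, c, -, h | h⟩ := NF_GG hg
  · rw [funext h]; unfold EE; fun_prop
  · rw [funext h]; unfold EE'; fun_prop

theorem GG_aff : ∀ g ∈ GG, ∀ (a b : Y₁) (s : ℝ),
    g ((1 - s) • a + s • b) = (1 - s) • g a + s • g b := by
  intro g hg x y s
  obtain ⟨n, a, -, b, -, c, -, h | h⟩ := NF_GG hg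
  · simp only [h, EE, Prod.fst_add, Prod.snd_add, Prod.smul_fst, Prod.smul_snd, Prod.smul_mk,
      Prod.mk_add_mk, Complex.real_smul, smul_eq_mul, Prod.mk.injEq]
    push_cast
    refine ⟨?_, ?_, ?_, ?_⟩ <;> ring
  · simp only [h, EE', Prod.fst_add, Prod.snd_add, Prod.smul_fst, Prod.smul_snd, Prod.smul_mk,
      Prod.mk_add_mk, Complex.real_smul, smul_eq_mul, Prod.mk.injEq, star_add, star_mul',
      Complex.star_def, Complex.conj_ofReal]
    push_cast
    refine ⟨?_, ?_, ?_, ?_⟩ <;> ring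

open Topology in
theorem GG_pd0 (y : Y₁) : ∀ᶠ p : Y₁ × Y₁ in 𝓝 (y, y), ∀ g ∈ GG, g p.1 = p.2 → g y = y := by
  obtain ⟨N, hN⟩ := int_disc (2 * y.1)
  have key : ∀ {E : Type} [TopologicalSpace E] (f : Y₁ × Y₁ → E) (c : E) (P : E → Prop),
      Continuous f → f (y, y) = c → (∀ᶠ x in 𝓝 c, P x) → ∀ᶠ p in 𝓝 (y, y), P (f p) := by
    intro E _ f c P hf hc hP
    subst hc
    exact hf.continuousAt.eventually hP
  have h0 : ∀ᶠ x : ℝ in 𝓝 0, |x| < 1 := by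
    filter_upwards [Metric.ball_mem_nhds (0 : ℝ) one_pos] with x hx
    simpa using hx
  have k0 := key (fun p => p.2.1 - p.1.1) 0 _ (by fun_prop) (by simp) h0
  have k1 := key (fun p => p.2.2.1 - p.1.2.1) 0 _ (by fun_prop) (by simp) (Γ_disc 0)
  have k2 := key (fun p => p.2.2.2.1 - p.1.2.2.1) 0 _ (by fun_prop) (by simp) (Γ_disc 0)
  have k3 := key (fun p => p.2.2.2.2 - p.1.2.2.2) 0 _ (by fun_prop) (by simp) (Γ_disc 0)
  have l0 := key (fun p => p.2.1 + p.1.1) (2 * y.1) _ (by fun_prop) (by ring) hN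
  have l1 := key (fun p => p.2.2.1 - (EE' N 0 0 0 p.1).2.1) _ _
    (by unfold EE'; fun_prop) rfl (Γ_disc _)
  have l2 := key (fun p => p.2.2.2.1 - (EE' N 0 0 0 p.1).2.2.1) _ _
    (by unfold EE'; fun_prop) rfl (Γ_disc _)
  have l3 := key (fun p => p.2.2.2.2 - (EE' N 0 0 0 p.1).2.2.2) _ _
    (by unfold EE'; fun_prop) rfl (Γ_disc _)
  filter_upwards [k0, k1, k2, k3, l0, l1, l2, l3] with ⟨w, w'⟩ k0 k1 k2 k3 l0 l1 l2 l3 g hg hgw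
  obtain ⟨n, a, ha, b, hb, c, hc, h | h⟩ := NF_GG hg
  · rw [h] at hgw ⊢
    simp only at hgw
    subst hgw
    have hn : n = 0 := by
      simp only [EE, add_sub_cancel_left] at k0
      have : |n| < 1 := by exact_mod_cast k0
      exact Int.abs_lt_one_iff.1 this
    subst hn
    simp only [EE, zpow_zero, one_mul, Int.cast_zero, zero_mul, sub_zero,
      add_sub_cancel_left] at k1 k2 k3
    rw [k1 ha, k2 hb, k3 hc]
    simp [EE]
  · rw [h] at hgw ⊢
    simp only at hgw
    subst hgw
    obtain ⟨rfl, h2⟩ := l0 n (by simp [EE'])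
    have h2' : (n : ℝ) + 1 = 2 * y.1 := by rw [← h2]; simp [EE']
    have l1' := l1 (by simpa [EE'] using ha)
    have l2' := l2 (by simpa [EE'] using hb)
    have l3' := l3 (by simpa [EE'] using hc)
    simp only [EE', add_zero, add_sub_cancel_left] at l1' l2' l3'
    rw [l1', l2', l3']
    refine Prod.ext ?_ (Prod.ext ?_ (Prod.ext ?_ ?_))
    · simp only [EE']; linarith
    · simp only [EE']; ring
    · simp only [EE']; ring
    · simp only [EE']; ring

open Topology in
theorem GG_pd (y : Y₁) : ∃ W : Set Y₁, IsOpen W ∧ Convex ℝ W ∧ y ∈ W ∧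
    ∀ g ∈ GG, ∀ w ∈ W, g w ∈ W → g y = y := by
  have h := GG_pd0 y
  rw [nhds_prod_eq, (Metric.nhds_basis_ball.prod_self).eventually_iff] at h
  obtain ⟨ε, hε, h⟩ := h
  refine ⟨Metric.ball y ε, Metric.isOpen_ball, convex_ball _ _, Metric.mem_ball_self hε, ?_⟩
  intro g hg w hw hgw
  exact h (x := (w, g w)) ⟨hw, hgw⟩ g hg rfl

/-! ### Generation by elements with fixed points -/

/-- The subgroup generated by elements with fixed points. -/
def NN : Subgroup (Equiv.Perm Y₁) := Subgroup.closure {g | g ∈ GG ∧ ∃ p, g p = p}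

theorem tau_mem : tauP ∈ GG := Subgroup.subset_closure (Or.inl rfl)
theorem kap_mem : kapP ∈ GG := Subgroup.subset_closure (Or.inr (Or.inl rfl))
theorem tra_mem {a b c : ℂ} (ha : a ∈ Γ₁) (hb : b ∈ Γ₁) (hc : c ∈ Γ₁) : traP a b c ∈ GG :=
  Subgroup.subset_closure (Or.inr (Or.inr ⟨a, ha, b, hb, c, hc, rfl⟩))

theorem kap_NN : kapP ∈ NN := by
  refine Subgroup.subset_closure ⟨kap_mem, (1 / 2, 0, 0, 0), ?_⟩
  rw [kapP_apply]; simp; norm_num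

theorem kt_NN : kapP * tauP ∈ NN := by
  refine Subgroup.subset_closure ⟨mul_mem kap_mem tau_mem, (0, 0, 0, 0), ?_⟩
  rw [Equiv.Perm.mul_apply, tauP_apply, kapP_apply]; simp

theorem tau_NN : tauP ∈ NN := (Subgroup.mul_mem_cancel_left _ kap_NN).1 kt_NN

theorem one_memΓ : (1 : ℂ) ∈ Γ₁ := mem_Γ.2 ⟨1, 0, by simp⟩
theorem u_memΓ : u₀ ∈ Γ₁ := mem_Γ.2 ⟨0, 1, by simp⟩

theorem star_half : star (1 / 2 : ℂ) = 1 / 2 := by simp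

theorem tra1_NN : traP 0 0 1 ∈ NN := by
  refine (Subgroup.mul_mem_cancel_right _ kap_NN).1 ?_
  refine Subgroup.subset_closure ⟨mul_mem (tra_mem (zero_mem _) (zero_mem _) one_memΓ) kap_mem,
    (1 / 2, 0, 0, 1 / 2), ?_⟩
  rw [Equiv.Perm.mul_apply, kapP_apply, traP_apply]
  simp only [star_half, star_zero]
  norm_num

theorem tra2_NN : traP 1 (u₀ - 1) 0 ∈ NN := by
  refine (Subgroup.mul_mem_cancel_right _ kap_NN).1 ?_
  refine Subgroup.subset_closure
    ⟨mul_mem (tra_mem one_memΓ (sub_mem u_memΓ one_memΓ) (zero_mem _)) kap_mem,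
    (1 / 2, 1 / 2, (u₀ - 1) * (1 / 2), 0), ?_⟩
  rw [Equiv.Perm.mul_apply, kapP_apply, traP_apply]
  simp only [star_half, star_zero, star_mul', star_sub, star_one, star_u₀, Prod.mk.injEq]
  refine ⟨?_, ?_, ?_, ?_⟩
  · norm_num
  all_goals ring

theorem tra3_NN : traP 0 u₀ 0 ∈ NN := by
  refine (Subgroup.mul_mem_cancel_right _ kt_NN).1 ?_
  refine Subgroup.subset_closure
    ⟨mul_mem (tra_mem (zero_mem _) u_memΓ (zero_mem _)) (mul_mem kap_mem tau_mem),
    (0, 0, u₀ * (1 / 2), 0), ?_⟩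
  rw [Equiv.Perm.mul_apply, Equiv.Perm.mul_apply, tauP_apply, kapP_apply, traP_apply]
  simp only [star_half, star_zero, star_mul', star_sub, star_u₀, Prod.mk.injEq, mul_zero]
  refine ⟨?_, ?_, ?_, ?_⟩
  · norm_num
  · ring
  · linear_combination (1 / 2) * u₀_sq
  · ring

/-- Translations which lie in `NN`. -/
def SS : AddSubgroup (ℂ × ℂ × ℂ) where
  carrier := {v | traP v.1 v.2.1 v.2.2 ∈ NN}
  zero_mem' := by
    have : traP 0 0 0 = 1 := by ext1 y; rw [traP_apply]; simp
    change traP 0 0 0 ∈ NN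
    rw [this]; exact one_mem _
  add_mem' := by
    rintro ⟨a, b, c⟩ ⟨a', b', c'⟩ h h'
    have : traP (a + a') (b + b') (c + c') = traP a b c * traP a' b' c' := by
      ext1 y
      rw [Equiv.Perm.mul_apply]
      simp only [traP_apply, Prod.mk.injEq]
      refine ⟨trivial, ?_, ?_, ?_⟩ <;> ring
    change traP (a + a') (b + b') (c + c') ∈ NN
    rw [this]; exact mul_mem h h'
  neg_mem' := by
    rintro ⟨a, b, c⟩ h
    change traP (-a) (-b) (-c) ∈ NN
    rw [← traP_inv]; exact inv_mem h

theorem SS_A {a b c : ℂ} (h : (a, b, c) ∈ SS) : (u₀ * a, u₀ * b - u₀ * a, -u₀ * c) ∈ SS := by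
  have e : traP (u₀ * a) (u₀ * b - u₀ * a) (-u₀ * c) * tauP = tauP * traP a b c := by
    ext1 y
    simp only [Equiv.Perm.mul_apply, traP_apply, tauP_apply, Prod.mk.injEq]
    refine ⟨trivial, ?_, ?_, ?_⟩ <;> ring
  change traP _ _ _ ∈ NN
  refine (Subgroup.mul_mem_cancel_right _ tau_NN).1 ?_
  simp only
  rw [e]
  exact mul_mem tau_NN h

theorem SS_all {a b c : ℂ} (ha : a ∈ Γ₁) (hb : b ∈ Γ₁) (hc : c ∈ Γ₁) : (a, b, c) ∈ SS := by
  have c1 : ((0, 0, 1) : ℂ × ℂ × ℂ) ∈ SS := tra1_NN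
  have c2 : ((0, 0, -u₀) : ℂ × ℂ × ℂ) ∈ SS := by simpa using SS_A c1
  have b1 : ((0, u₀, 0) : ℂ × ℂ × ℂ) ∈ SS := tra3_NN
  have b2 : ((0, u₀ - 1, 0) : ℂ × ℂ × ℂ) ∈ SS := by simpa [u₀_sq] using SS_A b1
  have a1 : ((1, 0, 0) : ℂ × ℂ × ℂ) ∈ SS := by
    have h : ((1, u₀ - 1, 0) : ℂ × ℂ × ℂ) ∈ SS := tra2_NN
    convert sub_mem h b2 using 1; simp [Prod.zero_eq_mk]
  have a2 : ((u₀, 0, 0) : ℂ × ℂ × ℂ) ∈ SS := by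
    have h : ((u₀, -u₀, 0) : ℂ × ℂ × ℂ) ∈ SS := by simpa using SS_A a1
    simpa using add_mem h b1
  obtain ⟨m, n, rfl⟩ := mem_Γ.1 ha
  obtain ⟨m', n', rfl⟩ := mem_Γ.1 hb
  obtain ⟨m'', n'', rfl⟩ := mem_Γ.1 hc
  have := add_mem (add_mem (add_mem (zsmul_mem a1 m) (zsmul_mem a2 n))
    (add_mem (zsmul_mem b1 (n' + m')) (zsmul_mem b2 (-m'))))
    (add_mem (zsmul_mem c1 m'') (zsmul_mem c2 (-n'')))
  convert this using 1
  simp only [Prod.smul_mk, Prod.mk_add_mk, zsmul_eq_mul, Prod.mk.injEq]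
  push_cast
  refine ⟨?_, ?_, ?_⟩ <;> ring

theorem GG_gen : GG ≤ Subgroup.closure {g | g ∈ GG ∧ ∃ p, g p = p} := by
  change GG ≤ NN
  unfold GG
  rw [Subgroup.closure_le]
  rintro g (rfl | rfl | ⟨a, ha, b, hb, c, hc, rfl⟩)
  · exact tau_NN
  · exact kap_NN
  · exact SS_all ha hb hc

/-! ### The quotient map -/

theorem fib_step {Y Z : Type*} (G : Subgroup (Equiv.Perm Y)) (p : Y → Z)
    (hs : Function.Surjective p) (r : Z → Z → Prop) (f : Z → Z) (hr : ∀ a b, r a b → b = f a)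
    (g₀ : Equiv.Perm Y) (hg₀ : g₀ ∈ G) (hf : ∀ y, p (g₀ y) = f (p y))
    (hp : ∀ y y', p y = p y' → ∃ g ∈ G, g y = y') (y y' : Y)
    (h : Quot.mk r (p y) = Quot.mk r (p y')) : ∃ g ∈ G, g y = y' := by
  have key : ∀ a b, Relation.EqvGen r a b → ∀ y y', p y = a → p y' = b → ∃ g ∈ G, g y = y' := by
    intro a b hab
    induction hab with
    | rel a b hab =>
      rintro y y' rfl rfl
      obtain ⟨g, hg, h⟩ := hp (g₀ y) y' (by rw [hf, hr _ _ hab])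
      exact ⟨g * g₀, mul_mem hg hg₀, h⟩
    | refl a =>
      rintro y y' rfl h
      exact hp _ _ h.symm
    | symm a b _ ih =>
      intro y y' h h'
      obtain ⟨g, hg, h⟩ := ih y' y h' h
      exact ⟨g⁻¹, inv_mem hg, by rw [← h]; simp⟩
    | trans a b c _ _ ih1 ih2 =>
      intro y y' h h'
      obtain ⟨z, hz⟩ := hs b
      obtain ⟨g, hg, h1⟩ := ih1 y z h hz
      obtain ⟨g', hg', h2⟩ := ih2 z y' hz h'
      exact ⟨g' * g, mul_mem hg' hg, by rw [Equiv.Perm.mul_apply, h1, h2]⟩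
  exact key _ _ (Quot.eqvGen_exact h) y y' rfl rfl

/-- The covering `ℝ × ℂ³ → ℝ × T`. -/
noncomputable def pp (y : Y₁) : ℝ × T₁ := (y.1, mk₁ y.2.1, mk₁ y.2.2.1, mk₁ y.2.2.2)

theorem mk₁_oq : IsOpenQuotientMap mk₁ := QuotientAddGroup.isOpenQuotientMap_mk

theorem pp_oq : IsOpenQuotientMap pp :=
  IsOpenQuotientMap.id.prodMap (mk₁_oq.prodMap (mk₁_oq.prodMap mk₁_oq))

theorem mk₁_eq {a b : ℂ} : mk₁ a = mk₁ b ↔ b - a ∈ Γ₁ := by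
  unfold mk₁
  rw [QuotientAddGroup.eq, neg_add_eq_sub]

theorem pp_fib (y y' : Y₁) (h : pp y = pp y') : ∃ g ∈ GG, g y = y' := by
  simp only [pp, Prod.mk.injEq, mk₁_eq] at h
  obtain ⟨h0, h1, h2, h3⟩ := h
  refine ⟨_, tra_mem h1 h2 h3, ?_⟩
  rw [traP_apply]
  simp [h0]

/-- Let `F : T → T` be induced by `z ↦ (uz₁, uz₂ − uz₁, exp(−2πi/3)z₃)`, `M` the
mapping torus of `F`, `κ[t,x] = [1−t, η x]` with `η` induced by
`z ↦ (−z̄₁, z̄₂ + z̄₁, −z̄₃)`, and `X = M/κ`. Then `X` is simply connected. -/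
theorem simply_connected_X161 (F : T₁ → T₁)
    (hF : ∀ z₁ z₂ z₃ : ℂ,
      F (mk₁ z₁, mk₁ z₂, mk₁ z₃) =
        (mk₁ (u₀ * z₁), mk₁ (u₀ * z₂ - u₀ * z₁),
          mk₁ (Complex.exp (-(2 * Real.pi * Complex.I) / 3) * z₃)))
    (κ : Quot (mtRel F) → Quot (mtRel F))
    (hκ : ∀ (t : ℝ) (z₁ z₂ z₃ : ℂ),
      κ (Quot.mk (mtRel F) (t, (mk₁ z₁, mk₁ z₂, mk₁ z₃))) =
        Quot.mk (mtRel F)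
          (1 - t, (mk₁ (-(star z₁)), mk₁ (star z₂ + star z₁), mk₁ (-(star z₃))))) :
    SimplyConnectedSpace (Quot (fun a b => b = κ a)) := by
  have hpp : ∀ t z₁ z₂ z₃, pp (t, z₁, z₂, z₃) = (t, mk₁ z₁, mk₁ z₂, mk₁ z₃) := fun _ _ _ _ => rfl
  let q1 : Y₁ → Quot (mtRel F) := fun y => Quot.mk _ (pp y)
  let q : Y₁ → Quot (fun a b => b = κ a) := fun y => Quot.mk _ (q1 y)
  have hq1s : Function.Surjective q1 := Quot.mk_surjective.comp pp_oq.surjective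
  have hqq : Topology.IsQuotientMap q :=
    isQuotientMap_quot_mk.comp (isQuotientMap_quot_mk.comp pp_oq.isQuotientMap)
  have htau : ∀ y, pp (tauP y) = ((pp y).1 + 1, F (pp y).2) := by
    rintro ⟨t, z₁, z₂, z₃⟩
    rw [tauP_apply, hpp, hpp, hF, exp_eq]
  have hkap : ∀ y, q1 (kapP y) = κ (q1 y) := by
    rintro ⟨t, z₁, z₂, z₃⟩
    exact (hκ t z₁ z₂ z₃).symm
  have hfib1 : ∀ y y', q1 y = q1 y' → ∃ g ∈ GG, g y = y' := by
    intro y y' h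
    exact fib_step GG pp pp_oq.surjective (mtRel F) (fun x => (x.1 + 1, F x.2))
      (fun _ _ h => h) tauP tau_mem htau pp_fib y y' h
  have hfib2 : ∀ y y', q y = q y' → ∃ g ∈ GG, g y = y' := by
    intro y y' h
    exact fib_step GG q1 hq1s (fun a b => b = κ a) κ
      (fun _ _ h => h) kapP kap_mem hkap hfib1 y y' h
  have hinv : ∀ g ∈ GG, ∀ y, q (g y) = q y := by
    intro g hg
    induction hg using Subgroup.closure_induction with
    | mem g hg =>
      intro y
      rcases hg with rfl | rfl | ⟨a, ha, b, hb, c, hc, rfl⟩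
      · have : q1 (tauP y) = q1 y := (Quot.sound (r := mtRel F) (htau y)).symm
        simp only [q, this]
      · exact (Quot.sound (r := fun a b => b = κ a) (hkap y)).symm
      · have : pp (traP a b c y) = pp y := by
          rw [traP_apply]
          simp only [pp, Prod.mk.injEq, mk₁_eq]
          refine ⟨trivial, ?_, ?_, ?_⟩ <;> simpa
        simp only [q, q1, this]
    | one => intro y; rfl
    | mul g k _ _ ihg ihk => intro y; rw [Equiv.Perm.mul_apply, ihg, ihk]
    | inv g _ ih => intro y; rw [← ih (g⁻¹ y)]; simp
  have hfib : ∀ y y', q y = q y' ↔ ∃ g ∈ GG, g y = y' :=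
    fun y y' => ⟨hfib2 y y', fun ⟨g, hg, h⟩ => by rw [← h, hinv g hg]⟩
  have hopen : IsOpenMap q := by
    intro V hV
    rw [← hqq.isOpen_preimage]
    have : q ⁻¹' (q '' V) = ⋃ g ∈ GG, g ⁻¹' V := by
      ext y
      simp only [Set.mem_preimage, Set.mem_image, Set.mem_iUnion, exists_prop]
      constructor
      · rintro ⟨v, hv, h⟩
        obtain ⟨g, hg, h⟩ := hfib2 _ _ h.symm
        exact ⟨g, hg, by rwa [h]⟩
      · rintro ⟨g, hg, h⟩
        exact ⟨g y, h, hinv g hg y⟩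
    rw [this]
    exact isOpen_biUnion fun g hg => hV.preimage (GG_cont g hg)
  exact quo_simplyConnected GG q ⟨hqq.surjective, hqq.continuous, hopen⟩ hfib GG_cont GG_aff GG_pd
    GG_gen
end

section
/- For t ∈ ℝ, let ω_t be the real alternating 2-form on ℂ³ given by ω_t = (i/2)[ (1+t²) dz₁∧dz̄₁ + dz₂∧dz̄₂ + dz₃∧dz̄₃ + t (dz₁∧dz̄₂ − dz̄₁∧dz₂) ]. Define the ℝ-linear maps f(z) = (z₁, z₂ − z₁, z₃), R_a(z) = (e^{2πi/a}z₁, e^{2πi/a}z₂, e^{−4πi/a}z₃) (a a nonzero real), and η(z) = (−z̄₁, z̄₂ + z̄₁, −z̄₃). Then: (a) f*ω₁ = ω₀; (b) R_a*ω_t = ω_t for every t; (c) η*ω_t = −ω_{1−t} for every t; and (d) η*(Re(dz₁∧dz₂∧dz₃)) = Re(dz₁∧dz₂∧dz₃). -/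
/-- The complex rotation `R_a(z) = (e^{2πi/a}z₁, e^{2πi/a}z₂, e^{−4πi/a}z₃)` on `ℂ³`. -/
noncomputable def Rot (a : ℝ) : ℂ × ℂ × ℂ → ℂ × ℂ × ℂ := fun z =>
  (Complex.exp (2 * Real.pi * Complex.I / (a : ℂ)) * z.1,
   Complex.exp (2 * Real.pi * Complex.I / (a : ℂ)) * z.2.1,
   Complex.exp (-(4 * Real.pi * Complex.I) / (a : ℂ)) * z.2.2)

/-- The shear `f(z) = (z₁, z₂ − z₁, z₃)`. -/
def fShear : ℂ × ℂ × ℂ → ℂ × ℂ × ℂ := fun z => (z.1, z.2.1 - z.1, z.2.2)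

/-- The map `η(z) = (−z̄₁, z̄₂ + z̄₁, −z̄₃)`. -/
noncomputable def etaMap : ℂ × ℂ × ℂ → ℂ × ℂ × ℂ := fun z =>
  (-(star z.1), star z.2.1 + star z.1, -(star z.2.2))

/-- Pullback identities for the family of real alternating 2-forms
`ω_t = (i/2)[(1+t²)dz₁∧dz̄₁ + dz₂∧dz̄₂ + dz₃∧dz̄₃ + t(dz₁∧dz̄₂ − dz̄₁∧dz₂)]`
(with the convention `(i/2)(dz_p∧dz̄_q)(v,w) = Im(v_p · conj w_q)`) and the real
3-form `ψ = Re(dz₁∧dz₂∧dz₃)`: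
(a) `f*ω₁ = ω₀`, (b) `R_a*ω_t = ω_t`, (c) `η*ω_t = −ω_{1−t}`, (d) `η*ψ = ψ`. -/
theorem pullback_identities_omega
    (ω : ℝ → AlternatingMap ℝ (ℂ × ℂ × ℂ) ℝ (Fin 2))
    (ψ : AlternatingMap ℝ (ℂ × ℂ × ℂ) ℝ (Fin 3))
    (hω : ∀ (t : ℝ) (v w : ℂ × ℂ × ℂ),
      ω t ![v, w] =
        (1 + t ^ 2) * (v.1 * star w.1).im + (v.2.1 * star w.2.1).im
          + (v.2.2 * star w.2.2).im
          + t * ((v.1 * star w.2.1).im + (v.2.1 * star w.1).im))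
    (hψ : ∀ v w u : ℂ × ℂ × ℂ,
      ψ ![v, w, u] =
        (Matrix.det !![v.1, v.2.1, v.2.2; w.1, w.2.1, w.2.2; u.1, u.2.1, u.2.2]).re) :
    -- (a) f*ω₁ = ω₀
    (∀ v w : ℂ × ℂ × ℂ, ω 1 ![fShear v, fShear w] = ω 0 ![v, w]) ∧
    -- (b) R_a*ω_t = ω_t
    (∀ a : ℝ, a ≠ 0 → ∀ (t : ℝ) (v w : ℂ × ℂ × ℂ),
      ω t ![Rot a v, Rot a w] = ω t ![v, w]) ∧
    -- (c) η*ω_t = −ω_{1−t}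
    (∀ (t : ℝ) (v w : ℂ × ℂ × ℂ),
      ω t ![etaMap v, etaMap w] = -(ω (1 - t) ![v, w])) ∧
    -- (d) η*(Re(dz₁∧dz₂∧dz₃)) = Re(dz₁∧dz₂∧dz₃)
    (∀ v w u : ℂ × ℂ × ℂ, ψ ![etaMap v, etaMap w, etaMap u] = ψ ![v, w, u]) := by
  refine ⟨?_, ?_, ?_, ?_⟩
  · intro v w
    rw [hω, hω]
    simp [fShear]
    ring
  · intro a _ t v w
    rw [hω, hω]
    have key : ∀ c x y : ℂ, c * star c = 1 → (c * x) * star (c * y) = x * star y := by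
      intro c x y h
      rw [star_mul']
      linear_combination (x * star y) * h
    have h1 : ∀ r : ℝ, Complex.exp (r * Complex.I) * star (Complex.exp (r * Complex.I)) = 1 := by
      intro r
      have h : star (Complex.exp (r * Complex.I)) = Complex.exp (-(r * Complex.I)) := by
        rw [Complex.star_def, ← Complex.exp_conj]
        simp
      rw [h, ← Complex.exp_add]
      simp
    have e1 := h1 (2 * Real.pi / a)
    have e2 := h1 (-(4 * Real.pi) / a)
    have r1 : ((2 * Real.pi / a : ℝ) : ℂ) * Complex.I = 2 * Real.pi * Complex.I / (a : ℂ) := by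
      push_cast
      ring
    have r2 : ((-(4 * Real.pi) / a : ℝ) : ℂ) * Complex.I
        = -(4 * Real.pi * Complex.I) / (a : ℂ) := by
      push_cast
      ring
    rw [r1] at e1
    rw [r2] at e2
    simp only [Rot]
    rw [key _ _ _ e1, key _ _ _ e1, key _ _ _ e2, key _ _ _ e1, key _ _ _ e1]
  · intro t v w
    rw [hω, hω]
    simp [etaMap]
    ring
  · intro v w u
    rw [hψ, hψ]
    simp [etaMap, Matrix.det_fin_three]
    ring
end
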